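/- Let d ≥ 1 be an integer, let f : [0,∞) → (0,∞) be Lipschitz with f(s) ≤ f(0) =: θ for all s ≥ 0, let φ : B₁' → ℝ be of class C^{1,1}, and let u be a solution of the two-phase thin obstacle problem in B₁ with ∫_{B₁⁺}(|u|² + |∇u|²) < ∞. Then there exists r > 0, depending only on d, θ, ‖u‖_{L²(B₁⁺)}, the Lipschitz constant of f, and ‖φ‖_{C^{1,1}}, such that for every x ∈ B'_{1/2}, either u(·,0) ≥ φ on B_r(x) ∩ B₁' or u(·,0) ≤ φ on B_r(x) ∩ B₁'. In particular, no point of B'_{1/2} lies simultaneously in the closure of {x ∈ B₁' : u(x,0) > φ(x)} and in the closure of {x ∈ B₁' : u(x,0) < φ(x)}. -/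

import Mathlib

open MeasureTheory Set

/-- Euclidean space `ℝ^d`. -/
abbrev Esp (d : ℕ) := EuclideanSpace ℝ (Fin d)

/-- The upper half-ball `B_r⁺ = B_r ∩ {y > 0}` in `ℝ^{d+1} = ℝ^d × ℝ`. -/
def upBall (d : ℕ) (r : ℝ) : Set (Esp d × ℝ) := {p | ‖p.1‖^2 + p.2^2 < r^2 ∧ 0 < p.2}

/-- The thin ball `B_r' = B_r ∩ {y = 0}` in `ℝ^{d+1} = ℝ^d × ℝ`. -/
def flatBall (d : ℕ) (r : ℝ) : Set (Esp d × ℝ) := {p | ‖p.1‖^2 + p.2^2 < r^2 ∧ p.2 = 0}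

/-- Laplacian on `ℝ^d × ℝ`, computed through iterated coordinate derivatives. -/
noncomputable def lapH (d : ℕ) (u : Esp d × ℝ → ℝ) (p : Esp d × ℝ) : ℝ :=
  (∑ i : Fin d,
    deriv (deriv (fun t : ℝ => u (p.1 + t • EuclideanSpace.single i (1:ℝ), p.2))) 0)
  + deriv (deriv (fun t : ℝ => u (p.1, p.2 + t))) 0

/-- `u` is harmonic on the open set `U`: it is `C²` there and its Laplacian vanishes. -/
def HarmonicOnH (d : ℕ) (u : Esp d × ℝ → ℝ) (U : Set (Esp d × ℝ)) : Prop :=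
  ContDiffOn ℝ 2 u U ∧ ∀ p ∈ U, lapH d u p = 0

/-- Vertical partial derivative `∂_y u`. -/
noncomputable def pdy (d : ℕ) (u : Esp d × ℝ → ℝ) (p : Esp d × ℝ) : ℝ :=
  deriv (fun t : ℝ => u (p.1, p.2 + t)) 0

/-- Squared norm of the tangential gradient `|∇_x u|²`. -/
noncomputable def tangGradSq (d : ℕ) (u : Esp d × ℝ → ℝ) (p : Esp d × ℝ) : ℝ :=
  ∑ i : Fin d,
    (deriv (fun t : ℝ => u (p.1 + t • EuclideanSpace.single i (1:ℝ), p.2)) 0)^2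

/-- Squared norm of the full gradient `|∇u|²`. -/
noncomputable def gradSqH (d : ℕ) (u : Esp d × ℝ → ℝ) (p : Esp d × ℝ) : ℝ :=
  tangGradSq d u p + (pdy d u p)^2

/-- `L` is the one-sided vertical derivative `∂_y u(x,0⁺)`. -/
def NormalDeriv (d : ℕ) (u : Esp d × ℝ → ℝ) (x : Esp d) (L : ℝ) : Prop :=
  Filter.Tendsto (fun t => (u (x, t) - u (x, 0)) / t) (nhdsWithin 0 (Set.Ioi 0)) (nhds L)

/-- `f : [0,∞) → (0,∞)` is `L`-Lipschitz with `f ≤ f 0 = θ`. -/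
def GoodF (θ L : ℝ) (f : ℝ → ℝ) : Prop :=
  f 0 = θ ∧ (∀ s : ℝ, 0 ≤ s → 0 < f s ∧ f s ≤ θ) ∧
  (∀ s t : ℝ, 0 ≤ s → 0 ≤ t → |f s - f t| ≤ L * |s - t|)

/-- `u` is a solution of the two-phase thin obstacle problem in `B₁` with nonlinearity `f`
and obstacle `φ`: continuous on `B₁⁺ ∪ B₁'`, harmonic in `B₁⁺`, and on `B₁'` the one-sided
vertical derivative exists, is bounded by `θ` in absolute value, and equals
`f(|u−φ|)·sign(u−φ)` off the contact set. -/
def TwoPhaseSolH (d : ℕ) (θ : ℝ) (f : ℝ → ℝ) (φ : Esp d → ℝ) (u : Esp d × ℝ → ℝ) : Prop :=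
  ContinuousOn u (upBall d 1 ∪ flatBall d 1) ∧
  HarmonicOnH d u (upBall d 1) ∧
  ∀ x : Esp d, ‖x‖ < 1 → ∃ L : ℝ, NormalDeriv d u x L ∧ |L| ≤ θ ∧
    (u (x, 0) ≠ φ x → L = f |u (x, 0) - φ x| * Real.sign (u (x, 0) - φ x))

/-- `φ` is of class `C^{1,1}` on `B₁'` with `C^{1,1}` norm at most `P`. -/
def C11Bound (d : ℕ) (P : ℝ) (φ : Esp d → ℝ) : Prop :=
  (∀ x : Esp d, ‖x‖ < 1 → DifferentiableAt ℝ φ x ∧ |φ x| ≤ P ∧ ‖fderiv ℝ φ x‖ ≤ P) ∧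
  (∀ x y : Esp d, ‖x‖ < 1 → ‖y‖ < 1 → ‖fderiv ℝ φ x - fderiv ℝ φ y‖ ≤ P * ‖x - y‖)

open scoped RealInnerProductSpace Topology

/-- `g` has second derivative `a` at `0`. -/
def HasSecondDeriv (g : ℝ → ℝ) (a : ℝ) : Prop :=
  ∃ g' : ℝ → ℝ, (∀ᶠ t in 𝓝 0, HasDerivAt g (g' t) t) ∧ HasDerivAt g' a 0

namespace HasSecondDeriv

variable {g h : ℝ → ℝ} {a b : ℝ}

theorem add (hg : HasSecondDeriv g a) (hh : HasSecondDeriv h b) :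
    HasSecondDeriv (fun t => g t + h t) (a + b) := by
  obtain ⟨g', h1, h2⟩ := hg
  obtain ⟨h', h3, h4⟩ := hh
  refine ⟨fun t => g' t + h' t, ?_, h2.add h4⟩
  filter_upwards [h1, h3] with t ht ht' using ht.add ht'

theorem const_mul (c : ℝ) (hg : HasSecondDeriv g a) :
    HasSecondDeriv (fun t => c * g t) (c * a) := by
  obtain ⟨g', h1, h2⟩ := hg
  refine ⟨fun t => c * g' t, ?_, h2.const_mul c⟩
  filter_upwards [h1] with t ht using ht.const_mul c

theorem comp_const_mul (c : ℝ) (hg : HasSecondDeriv g a) :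
    HasSecondDeriv (fun t => g (c * t)) (c ^ 2 * a) := by
  obtain ⟨g', h1, h2⟩ := hg
  have hl : ∀ t : ℝ, HasDerivAt (fun t : ℝ => c * t) c t := fun t => by
    simpa using (hasDerivAt_id t).const_mul c
  have hc : Filter.Tendsto (fun t : ℝ => c * t) (𝓝 0) (𝓝 0) := by
    have : Continuous (fun t : ℝ => c * t) := by fun_prop
    simpa using this.tendsto 0
  refine ⟨fun t => c * g' (c * t), ?_, ?_⟩
  · filter_upwards [hc.eventually h1] with t ht
    have := HasDerivAt.comp t ht (hl t)
    simpa [Function.comp_def, mul_comm] using this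
  · have h2' : HasDerivAt g' a (c * 0) := by simpa using h2
    have := (HasDerivAt.comp (0 : ℝ) h2' (hl 0)).const_mul c
    have e : c * (a * c) = c ^ 2 * a := by ring
    rw [e] at this
    simpa [Function.comp_def] using this

theorem cubic (c₀ c₁ c₂ c₃ : ℝ) :
    HasSecondDeriv (fun t => c₀ + c₁ * t + c₂ * t ^ 2 + c₃ * t ^ 3) (2 * c₂) := by
  refine ⟨fun t => c₁ + 2 * c₂ * t + 3 * c₃ * t ^ 2, Filter.Eventually.of_forall fun t => ?_, ?_⟩
  · have h1 := (hasDerivAt_id t).const_mul c₁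
    have h2 := (hasDerivAt_pow 2 t).const_mul c₂
    have h3 := (hasDerivAt_pow 3 t).const_mul c₃
    have := ((h1.const_add c₀).add h2).add h3
    convert! this using 1
    simp
    ring
  · have h1 := (hasDerivAt_id (0 : ℝ)).const_mul (2 * c₂)
    have h2 := (hasDerivAt_pow 2 (0 : ℝ)).const_mul (3 * c₃)
    have := ((h1.const_add c₁).add h2)
    convert! this using 1
    simp

theorem exp_quadratic (c₀ c₁ c₂ : ℝ) :
    HasSecondDeriv (fun t => Real.exp (c₀ + c₁ * t + c₂ * t ^ 2))
      ((c₁ ^ 2 + 2 * c₂) * Real.exp c₀) := by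
  have hq : ∀ t : ℝ, HasDerivAt (fun t => c₀ + c₁ * t + c₂ * t ^ 2) (c₁ + 2 * c₂ * t) t := by
    intro t
    have h1 := (hasDerivAt_id t).const_mul c₁
    have h2 := (hasDerivAt_pow 2 t).const_mul c₂
    have := (h1.const_add c₀).add h2
    convert! this using 1
    simp
    ring
  refine ⟨fun t => Real.exp (c₀ + c₁ * t + c₂ * t ^ 2) * (c₁ + 2 * c₂ * t),
    Filter.Eventually.of_forall fun t => (hq t).exp, ?_⟩
  have h1 := (hasDerivAt_id (0 : ℝ)).const_mul (2 * c₂)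
  have := (hq 0).exp.mul (h1.const_add c₁)
  convert! this using 1
  simp
  ring

theorem congr (hg : HasSecondDeriv g a) (e : ∀ t, h t = g t) (e' : b = a) :
    HasSecondDeriv h b := by
  obtain rfl : h = g := funext e
  exact e' ▸ hg

theorem deriv_deriv (hg : HasSecondDeriv g a) : deriv (deriv g) 0 = a := by
  obtain ⟨g', h1, h2⟩ := hg
  have : deriv g =ᶠ[𝓝 0] g' := h1.mono fun t ht => ht.deriv
  rw [this.deriv_eq]
  exact h2.deriv

theorem nonneg_of_isLocalMin (hg : HasSecondDeriv g a) (hm : IsLocalMin g 0) : 0 ≤ a := by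
  by_contra! ha
  have hd := hg.deriv_deriv
  have hc : ContinuousAt g 0 := by
    obtain ⟨g', h1, -⟩ := hg
    exact h1.self_of_nhds.continuousAt
  have hM := isLocalMax_of_deriv_deriv_neg (hd ▸ ha) hm.deriv_eq_zero hc
  have he : g =ᶠ[𝓝 0] fun _ => g 0 := by
    filter_upwards [hm, hM] with t h1 h2 using le_antisymm h2 h1
  have h1 : deriv g =ᶠ[𝓝 0] fun _ => 0 := by
    have := he.deriv
    simpa using this
  rw [h1.deriv_eq] at hd
  simp at hd
  exact ha.ne hd.symm

end HasSecondDeriv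

/-- `v` has pure second derivatives at `p` along the vertical direction and along every
horizontal orthonormal frame, and they add up to `l`. -/
def HasLaplacian {d : ℕ} (v : Esp d × ℝ → ℝ) (p : Esp d × ℝ) (l : ℝ) : Prop :=
  ∀ b : OrthonormalBasis (Fin d) ℝ (Esp d), ∃ (a : Fin d → ℝ) (c : ℝ),
    (∀ i, HasSecondDeriv (fun t => v (p.1 + t • b i, p.2)) (a i)) ∧
    HasSecondDeriv (fun t => v (p.1, p.2 + t)) c ∧ ∑ i, a i + c = l

namespace HasLaplacian

variable {d : ℕ} {v w : Esp d × ℝ → ℝ} {p : Esp d × ℝ} {l k : ℝ}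

theorem add (hv : HasLaplacian v p l) (hw : HasLaplacian w p k) :
    HasLaplacian (fun q => v q + w q) p (l + k) := by
  intro b
  obtain ⟨a, c, h1, h2, h3⟩ := hv b
  obtain ⟨a', c', h1', h2', h3'⟩ := hw b
  refine ⟨fun i => a i + a' i, c + c', fun i => (h1 i).add (h1' i), h2.add h2', ?_⟩
  rw [Finset.sum_add_distrib]
  linarith

theorem const_mul (r : ℝ) (hv : HasLaplacian v p l) :
    HasLaplacian (fun q => r * v q) p (r * l) := by
  intro b
  obtain ⟨a, c, h1, h2, h3⟩ := hv b
  refine ⟨fun i => r * a i, r * c, fun i => (h1 i).const_mul r, h2.const_mul r, ?_⟩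
  rw [← Finset.mul_sum, ← mul_add, h3]

theorem congr (hv : HasLaplacian v p l) (e : ∀ q, w q = v q) (e' : k = l) :
    HasLaplacian w p k := by
  obtain rfl : w = v := funext e
  exact e' ▸ hv

theorem sub (hv : HasLaplacian v p l) (hw : HasLaplacian w p k) :
    HasLaplacian (fun q => v q - w q) p (l - k) :=
  (hv.add (hw.const_mul (-1))).congr (fun q => by ring) (by ring)

theorem const (r : ℝ) : HasLaplacian (fun _ => r) p 0 := fun b =>
  ⟨fun _ => 0, 0, fun _ => (HasSecondDeriv.cubic r 0 0 0).congr (fun t => by ring) (by ring),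
    (HasSecondDeriv.cubic r 0 0 0).congr (fun t => by ring) (by ring), by simp⟩

theorem clm (e : Esp d →L[ℝ] ℝ) : HasLaplacian (fun q => e q.1) p 0 := fun b =>
  ⟨fun _ => 0, 0,
    fun i => (HasSecondDeriv.cubic (e p.1) (e (b i)) 0 0).congr
      (fun t => by simp; ring) (by ring),
    (HasSecondDeriv.cubic (e p.1) 0 0 0).congr (fun t => by ring) (by ring), by simp⟩

theorem snd : HasLaplacian (fun q : Esp d × ℝ => q.2) p 0 := fun b =>
  ⟨fun _ => 0, 0,
    fun i => (HasSecondDeriv.cubic p.2 0 0 0).congr (fun t => by ring) (by ring),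
    (HasSecondDeriv.cubic p.2 1 0 0).congr (fun t => by ring) (by ring), by simp⟩

theorem inner_mul_snd (m e : Esp d) :
    HasLaplacian (fun q : Esp d × ℝ => ⟪q.1 - m, e⟫ * q.2) p 0 := fun b =>
  ⟨fun _ => 0, 0,
    fun i => (HasSecondDeriv.cubic (⟪p.1 - m, e⟫ * p.2) (⟪b i, e⟫ * p.2) 0 0).congr
      (fun t => by
        dsimp only
        rw [add_sub_right_comm, inner_add_left, real_inner_smul_left]; ring) (by ring),
    (HasSecondDeriv.cubic (⟪p.1 - m, e⟫ * p.2) ⟪p.1 - m, e⟫ 0 0).congr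
      (fun t => by ring) (by ring), by simp⟩

theorem snd_sub_sq (c : ℝ) : HasLaplacian (fun q : Esp d × ℝ => (q.2 - c) ^ 2) p 2 := fun b =>
  ⟨fun _ => 0, 2,
    fun i => (HasSecondDeriv.cubic ((p.2 - c) ^ 2) 0 0 0).congr (fun t => by ring) (by ring),
    (HasSecondDeriv.cubic ((p.2 - c) ^ 2) (2 * (p.2 - c)) 1 0).congr
      (fun t => by ring) (by ring), by simp⟩

theorem _root_.norm_add_smul_sub_sq (b : OrthonormalBasis (Fin d) ℝ (Esp d)) (i : Fin d)
    (x m : Esp d) (t : ℝ) :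
    ‖x + t • b i - m‖ ^ 2 = ‖x - m‖ ^ 2 + 2 * ⟪x - m, b i⟫ * t + t ^ 2 := by
  rw [add_sub_right_comm, norm_add_sq_real, real_inner_smul_right, norm_smul, b.norm_eq_one]
  simp
  ring

theorem norm_sub_sq (m : Esp d) :
    HasLaplacian (fun q : Esp d × ℝ => ‖q.1 - m‖ ^ 2) p (2 * d) := fun b =>
  ⟨fun _ => 2, 0,
    fun i => (HasSecondDeriv.cubic (‖p.1 - m‖ ^ 2) (2 * ⟪p.1 - m, b i⟫) 1 0).congr
      (fun t => by simp only [norm_add_smul_sub_sq]; ring) (by ring),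
    (HasSecondDeriv.cubic (‖p.1 - m‖ ^ 2) 0 0 0).congr
      (fun t => by ring) (by ring), by simp; ring⟩

theorem gaussian (α : ℝ) (m : Esp d) (c : ℝ) :
    HasLaplacian (fun q : Esp d × ℝ => Real.exp (-α * (‖q.1 - m‖ ^ 2 + (q.2 - c) ^ 2))) p
      ((4 * α ^ 2 * (‖p.1 - m‖ ^ 2 + (p.2 - c) ^ 2) - 2 * α * (d + 1)) *
        Real.exp (-α * (‖p.1 - m‖ ^ 2 + (p.2 - c) ^ 2))) := by
  intro b
  set q₀ := -α * (‖p.1 - m‖ ^ 2 + (p.2 - c) ^ 2) with hq₀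
  refine ⟨fun i => ((-α * (2 * ⟪p.1 - m, b i⟫)) ^ 2 + 2 * (-α)) * Real.exp q₀,
    ((-α * (2 * (p.2 - c))) ^ 2 + 2 * (-α)) * Real.exp q₀,
    fun i => (HasSecondDeriv.exp_quadratic q₀ (-α * (2 * ⟪p.1 - m, b i⟫)) (-α)).congr
      (fun t => by simp only [norm_add_smul_sub_sq, hq₀]; congr 1; ring) rfl,
    (HasSecondDeriv.exp_quadratic q₀ (-α * (2 * (p.2 - c))) (-α)).congr
      (fun t => by simp only [hq₀]; congr 1; ring) rfl, ?_⟩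
  have hP := b.sum_sq_inner_left (p.1 - m)
  rw [← Finset.sum_mul, Finset.sum_add_distrib]
  have : ∑ i, (-α * (2 * ⟪p.1 - m, b i⟫)) ^ 2 = 4 * α ^ 2 * ‖p.1 - m‖ ^ 2 := by
    rw [← hP, Finset.mul_sum]
    exact Finset.sum_congr rfl fun i _ => by ring
  rw [this]
  simp
  ring

theorem not_isLocalMin (hv : HasLaplacian v p l) (hl : l < 0) : ¬ IsLocalMin v p := by
  intro hm
  obtain ⟨a, c, h1, h2, h3⟩ := hv (EuclideanSpace.basisFun (Fin d) ℝ)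
  have key : ∀ γ : ℝ → Esp d × ℝ, Continuous γ → γ 0 = p →
      IsLocalMin (fun t => v (γ t)) 0 := by
    intro γ hγ h0
    have : Filter.Tendsto γ (𝓝 0) (𝓝 p) := h0 ▸ hγ.tendsto 0
    have := this.eventually hm
    simpa [IsLocalMin, IsMinFilter, h0] using this
  have ha : ∀ i, 0 ≤ a i := fun i =>
    (h1 i).nonneg_of_isLocalMin (key (fun t => _) (by fun_prop) (by simp))
  have hc : 0 ≤ c := h2.nonneg_of_isLocalMin (key (fun t => _) (by fun_prop) (by simp))
  have := Finset.sum_nonneg fun i (_ : i ∈ Finset.univ) => ha i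
  linarith

theorem comp_isometry (σ : Esp d ≃ₗᵢ[ℝ] Esp d) (c : Esp d)
    (hv : HasLaplacian v (c + σ p.1, p.2) l) :
    HasLaplacian (fun q => v (c + σ q.1, q.2)) p l := by
  intro b
  obtain ⟨a, k, h1, h2, h3⟩ := hv (b.map σ)
  refine ⟨a, k, fun i => (h1 i).congr (fun t => ?_) rfl, h2, h3⟩
  simp [add_assoc]

theorem comp_snd_reflect (c : ℝ) (hv : HasLaplacian v (p.1, c - p.2) l) :
    HasLaplacian (fun q => v (q.1, c - q.2)) p l := by
  intro b
  obtain ⟨a, k, h1, h2, h3⟩ := hv b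
  refine ⟨a, k, fun i => h1 i, (h2.comp_const_mul (-1)).congr (fun t => ?_) (by ring), h3⟩
  simp
  congr 2
  ring

theorem comp_dilation (R : ℝ) (c : Esp d) (hv : HasLaplacian v (c + R • p.1, R * p.2) l) :
    HasLaplacian (fun q => v (c + R • q.1, R * q.2)) p (R ^ 2 * l) := by
  intro b
  obtain ⟨a, k, h1, h2, h3⟩ := hv b
  refine ⟨fun i => R ^ 2 * a i, R ^ 2 * k,
    fun i => ((h1 i).comp_const_mul R).congr (fun t => ?_) rfl,
    (h2.comp_const_mul R).congr (fun t => ?_) rfl, ?_⟩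
  · simp [smul_smul, add_assoc]
  · simp [mul_add]
  · rw [← Finset.mul_sum, ← mul_add, h3]

end HasLaplacian

theorem hasSecondDeriv_of_contDiffAt {E : Type*} [NormedAddCommGroup E] [NormedSpace ℝ E]
    {u : E → ℝ} {p : E} (hu : ContDiffAt ℝ 2 u p) (e : E) :
    HasSecondDeriv (fun t => u (p + t • e)) (fderiv ℝ (fderiv ℝ u) p e e) := by
  have hl : ∀ t : ℝ, HasDerivAt (fun t : ℝ => p + t • e) e t := fun t => by
    simpa using ((hasDerivAt_id t).smul_const e).const_add p
  have hc : Filter.Tendsto (fun t : ℝ => p + t • e) (𝓝 0) (𝓝 p) := by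
    have : Continuous (fun t : ℝ => p + t • e) := by fun_prop
    simpa using this.tendsto 0
  refine ⟨fun t => fderiv ℝ u (p + t • e) e, ?_, ?_⟩
  · filter_upwards [hc.eventually (hu.eventually (by simp))] with t ht
    exact (ht.differentiableAt (by simp)).hasFDerivAt.comp_hasDerivAt t (hl t)
  · have h1 : DifferentiableAt ℝ (fderiv ℝ u) p :=
      (hu.fderiv_right (m := 1) (by norm_num)).differentiableAt (by simp)
    have h2 : HasFDerivAt (fderiv ℝ u) (fderiv ℝ (fderiv ℝ u) p) (p + (0 : ℝ) • e) := by
      simpa using h1.hasFDerivAt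
    have h3 := h2.comp_hasDerivAt (0 : ℝ) (hl 0)
    exact (ContinuousLinearMap.apply ℝ ℝ e).hasFDerivAt.comp_hasDerivAt (0 : ℝ) h3

theorem OrthonormalBasis.sum_bilin_diag {d : ℕ} (b b' : OrthonormalBasis (Fin d) ℝ (Esp d))
    (β : Esp d →ₗ[ℝ] Esp d →ₗ[ℝ] ℝ) : ∑ i, β (b i) (b i) = ∑ i, β (b' i) (b' i) := by
  have h := (InnerProductSpace.canonicalCovariantTensor_eq_sum (Esp d) b).symm.trans
    (InnerProductSpace.canonicalCovariantTensor_eq_sum (Esp d) b')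
  simpa using congrArg (TensorProduct.lift β) h

theorem isOpen_upBall (d : ℕ) (r : ℝ) : IsOpen (upBall d r) := by
  have h1 : Continuous fun p : Esp d × ℝ => ‖p.1‖ ^ 2 + p.2 ^ 2 := by fun_prop
  exact (isOpen_lt h1 continuous_const).inter (isOpen_lt continuous_const continuous_snd)

theorem HarmonicOnH.hasLaplacian {d : ℕ} {u : Esp d × ℝ → ℝ} {r : ℝ}
    (hu : HarmonicOnH d u (upBall d r)) {p : Esp d × ℝ} (hp : p ∈ upBall d r) :
    HasLaplacian u p 0 := by
  have hC : ContDiffAt ℝ 2 u p := hu.1.contDiffAt ((isOpen_upBall d r).mem_nhds hp)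
  set D := fderiv ℝ (fderiv ℝ u) p with hD
  have hx : ∀ e : Esp d, HasSecondDeriv (fun t => u (p.1 + t • e, p.2)) (D (e, 0) (e, 0)) :=
    fun e => (hasSecondDeriv_of_contDiffAt hC (e, 0)).congr
      (fun t => congrArg u (Prod.ext (by simp) (by simp))) rfl
  have hy : HasSecondDeriv (fun t => u (p.1, p.2 + t)) (D (0, 1) (0, 1)) :=
    (hasSecondDeriv_of_contDiffAt hC (0, 1)).congr
      (fun t => congrArg u (Prod.ext (by simp) (by simp))) rfl
  intro b
  refine ⟨_, _, fun i => hx (b i), hy, ?_⟩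
  have h0 := hu.2 p hp
  rw [lapH, hy.deriv_deriv, Finset.sum_congr rfl fun i _ => (hx _).deriv_deriv] at h0
  let ι := LinearMap.inl ℝ (Esp d) ℝ
  let β : Esp d →ₗ[ℝ] Esp d →ₗ[ℝ] ℝ :=
    LinearMap.mk₂ ℝ (fun x y => D (x, 0) (y, 0))
      (fun x x' y => by
        have : ((x + x', 0) : Esp d × ℝ) = (x, 0) + (x', 0) := by simp
        rw [this, map_add]; rfl)
      (fun c x y => by
        have : ((c • x, 0) : Esp d × ℝ) = c • (x, 0) := by simp
        rw [this, map_smul]; rfl)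
      (fun x y y' => by
        have : ((y + y', 0) : Esp d × ℝ) = (y, 0) + (y', 0) := by simp
        rw [this, map_add])
      (fun c x y => by
        have : ((c • y, 0) : Esp d × ℝ) = c • (y, 0) := by simp
        rw [this, map_smul])
  have h1 := OrthonormalBasis.sum_bilin_diag b (EuclideanSpace.basisFun (Fin d) ℝ) β
  simp only [β, LinearMap.mk₂_apply, EuclideanSpace.basisFun_apply] at h1
  rw [h1]
  exact h0

namespace NormalDeriv

variable {d : ℕ} {v w : Esp d × ℝ → ℝ} {x : Esp d} {D D' : ℝ}

theorem sub (hv : NormalDeriv d v x D) (hw : NormalDeriv d w x D') :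
    NormalDeriv d (fun q => v q - w q) x (D - D') := by
  refine (Filter.Tendsto.sub hv hw).congr fun t => ?_
  ring

theorem add (hv : NormalDeriv d v x D) (hw : NormalDeriv d w x D') :
    NormalDeriv d (fun q => v q + w q) x (D + D') := by
  refine (Filter.Tendsto.add hv hw).congr fun t => ?_
  ring

theorem const_mul (c : ℝ) (hv : NormalDeriv d v x D) :
    NormalDeriv d (fun q => c * v q) x (c * D) := by
  refine (Filter.Tendsto.const_mul c hv).congr fun t => ?_
  ring

theorem of_hasDerivAt (h : HasDerivAt (fun t => v (x, t)) D 0) : NormalDeriv d v x D := by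
  have h1 := (hasDerivAt_iff_tendsto_slope_zero.1 h).mono_left
    (nhdsWithin_mono 0 (fun t (ht : 0 < t) => ht.ne'))
  refine h1.congr fun t => ?_
  simp only [zero_add, smul_eq_mul]
  rw [inv_mul_eq_div]

theorem eventually_lt (h : NormalDeriv d v x D) (hD : D < 0) :
    ∀ᶠ t in 𝓝[>] (0 : ℝ), v (x, t) < v (x, 0) := by
  filter_upwards [Filter.Tendsto.eventually_lt_const hD h, self_mem_nhdsWithin] with t ht ht0
  have : (0 : ℝ) < t := ht0
  rw [div_lt_iff₀ this] at ht
  linarith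

end NormalDeriv

/-- The affine function measuring the distance to the hyperplane through `(m, yt)` orthogonal
to `(e, ey)`. -/
noncomputable def hyperDist {d : ℕ} (m e : Esp d) (yt ey : ℝ) (q : Esp d × ℝ) : ℝ :=
  ⟪q.1 - m, e⟫ + ey * (q.2 - yt)

/-- Squared Euclidean distance on `ℝ^d × ℝ`. -/
noncomputable def sqDist {d : ℕ} (m : Esp d) (yt : ℝ) (q : Esp d × ℝ) : ℝ :=
  ‖q.1 - m‖ ^ 2 + (q.2 - yt) ^ 2

theorem continuous_hyperDist {d : ℕ} (m e : Esp d) (yt ey : ℝ) :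
    Continuous (hyperDist m e yt ey) := by
  unfold hyperDist
  fun_prop

theorem continuous_sqDist {d : ℕ} (m : Esp d) (yt : ℝ) : Continuous (sqDist m yt) := by
  unfold sqDist
  fun_prop

theorem hyperDist_sq_le {d : ℕ} {m e : Esp d} {yt ey : ℝ} (he : ‖e‖ ^ 2 + ey ^ 2 = 1)
    (q : Esp d × ℝ) : hyperDist m e yt ey q ^ 2 ≤ sqDist m yt q := by
  unfold hyperDist sqDist
  have h1 := abs_real_inner_le_norm (q.1 - m) e
  set a := ⟪q.1 - m, e⟫
  set n := ‖q.1 - m‖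
  set k := ‖e‖
  set τ := q.2 - yt
  have h2 : a ^ 2 ≤ n ^ 2 * k ^ 2 := by
    rw [← mul_pow, ← sq_abs a]
    gcongr
  have h3 : a * (ey * τ) ≤ |a| * |ey * τ| := by
    rw [← abs_mul]; exact le_abs_self _
  have h4 : |a| * |ey * τ| ≤ (n * k) * (|ey| * |τ|) := by
    rw [abs_mul]
    gcongr
  have h5 : 2 * ((n * k) * (|ey| * |τ|)) ≤ n ^ 2 * ey ^ 2 + k ^ 2 * τ ^ 2 := by
    have := sq_nonneg (n * |ey| - k * |τ|)
    nlinarith [sq_abs ey, sq_abs τ]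
  nlinarith

theorem isCompact_of_sqDist_le {d : ℕ} {m : Esp d} {yt ρ : ℝ} (hρ : 0 ≤ ρ)
    {E : Set (Esp d × ℝ)} (hE : IsClosed E) (h : ∀ q ∈ E, sqDist m yt q ≤ ρ ^ 2) :
    IsCompact E := by
  refine ((isCompact_closedBall m ρ).prod (isCompact_Icc (a := yt - ρ) (b := yt + ρ))).of_isClosed_subset
    hE ?_
  intro q hq
  have hq := h q hq
  unfold sqDist at hq
  have h1 : ‖q.1 - m‖ ≤ ρ := abs_le_of_sq_le_sq' (by nlinarith [sq_nonneg (q.2 - yt)]) hρ |>.2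
  have h2 := abs_le_of_sq_le_sq' (a := q.2 - yt) (b := ρ) (by nlinarith [sq_nonneg ‖q.1 - m‖]) hρ
  refine ⟨by simpa [dist_eq_norm] using h1, ?_, ?_⟩ <;> linarith [h2.1, h2.2]

theorem hasLaplacian_quadratic_mul_affine {d : ℕ} {m e : Esp d} {yt ey : ℝ}
    (he : ‖e‖ ^ 2 + ey ^ 2 = 1) (c A a g lam : ℝ) (q : Esp d × ℝ) :
    HasLaplacian (fun q => (c * sqDist m yt q + A * hyperDist m e yt ey q
        - a * hyperDist m e yt ey q ^ 2 + g) * (1 - lam * (q.2 - yt))) q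
      ((1 - lam * (q.2 - yt)) * (2 * c * (d + 1) - 2 * a)
        - 2 * lam * (2 * c * (q.2 - yt) + ey * (A - 2 * a * hyperDist m e yt ey q))) := by
  intro b
  set τ := q.2 - yt with hτ
  set k := 1 - lam * τ with hk
  set s := hyperDist m e yt ey q with hs
  set n := ‖q.1 - m‖ with hn
  refine ⟨fun i => 2 * (k * (c - a * ⟪b i, e⟫ ^ 2)),
    2 * (k * (c - a * ey ^ 2) - lam * (2 * c * τ + ey * (A - 2 * a * s))),
    fun i => (HasSecondDeriv.cubic (k * (c * (n ^ 2 + τ ^ 2) + A * s - a * s ^ 2 + g))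
      (k * (2 * c * ⟪q.1 - m, b i⟫ + A * ⟪b i, e⟫ - 2 * a * s * ⟪b i, e⟫)) _ 0).congr
        (fun t => ?_) rfl,
    (HasSecondDeriv.cubic (k * (c * (n ^ 2 + τ ^ 2) + A * s - a * s ^ 2 + g))
      (k * (2 * c * τ + ey * (A - 2 * a * s))
        - lam * (c * (n ^ 2 + τ ^ 2) + A * s - a * s ^ 2 + g)) _
      (-lam * (c - a * ey ^ 2))).congr (fun t => ?_) rfl, ?_⟩
  · have h1 : hyperDist m e yt ey (q.1 + t • b i, q.2) = s + t * ⟪b i, e⟫ := by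
      simp only [hs, hyperDist]
      rw [add_sub_right_comm, inner_add_left, real_inner_smul_left]; ring
    simp only [h1, sqDist, norm_add_smul_sub_sq]
    ring
  · have h1 : hyperDist m e yt ey (q.1, q.2 + t) = s + t * ey := by
      simp only [hs, hyperDist]
      ring
    simp only [h1, sqDist, hk, hτ, hn]
    ring
  · have h1 := b.sum_sq_inner_right e
    have h2 : ∑ i, 2 * (k * (c - a * ⟪b i, e⟫ ^ 2)) = 2 * k * (d * c - a * ‖e‖ ^ 2) := by
      rw [← h1, Finset.mul_sum, ← Finset.mul_sum, ← Finset.mul_sum, Finset.sum_sub_distrib,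
        ← Finset.mul_sum]
      simp [Finset.mul_sum]
      ring
    rw [h2]
    have h3 : ‖e‖ ^ 2 = 1 - ey ^ 2 := by linarith
    rw [h3]
    ring

set_option maxHeartbeats 1000000 in
/-- A function on a half-ball that vanishes on the cutting hyperplane and satisfies a
Robin-type inequality on the flat bottom is controlled by a quadratic barrier. -/
theorem le_quadratic_barrier {d : ℕ} {W : Esp d × ℝ → ℝ} {m e : Esp d}
    {yt ρ ey lam M a A : ℝ} (he : ‖e‖ ^ 2 + ey ^ 2 = 1) (hey : 0 ≤ ey) (hyt : 0 ≤ yt)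
    (hρ : 0 < ρ) (hlam : 0 < lam) (hlρ : lam * ρ ≤ 1 / 2) (hM : 0 < M)
    (ha : a = (4 * d + 13) * M / ρ ^ 2) (hA : 2 * a * ρ ≤ A)
    (hc : ContinuousOn W
      {q | sqDist m yt q ≤ ρ ^ 2 ∧ 0 ≤ q.2 ∧ 0 ≤ hyperDist m e yt ey q})
    (hW : ∀ q, sqDist m yt q ≤ ρ ^ 2 → 0 ≤ q.2 → 0 ≤ hyperDist m e yt ey q → W q ≤ 2 * M)
    (h0 : ∀ q, sqDist m yt q ≤ ρ ^ 2 → 0 ≤ q.2 → hyperDist m e yt ey q = 0 → W q ≤ 0)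
    (hlap : ∀ q, sqDist m yt q < ρ ^ 2 → 0 < q.2 → 0 < hyperDist m e yt ey q →
      HasLaplacian W q 0)
    (hbot : ∀ x, sqDist m yt (x, 0) < ρ ^ 2 → 0 < hyperDist m e yt ey (x, 0) →
      ey = 0 ∧ ∃ D, NormalDeriv d W x D ∧
        (A / 2 * hyperDist m e yt ey (x, 0) < W (x, 0) → -(lam / 2) * W (x, 0) ≤ D))
    (q : Esp d × ℝ) (hq : sqDist m yt q ≤ ρ ^ 2) (hq0 : 0 ≤ q.2)
    (hqs : 0 ≤ hyperDist m e yt ey q) :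
    W q ≤ (4 * M / ρ ^ 2 * sqDist m yt q + A * hyperDist m e yt ey q
        - a * hyperDist m e yt ey q ^ 2) * (1 - lam * (q.2 - yt)) := by
  set E : Set (Esp d × ℝ) :=
    {q | sqDist m yt q ≤ ρ ^ 2 ∧ 0 ≤ q.2 ∧ 0 ≤ hyperDist m e yt ey q} with hE
  set c := 4 * M / ρ ^ 2 with hcdef
  have hc0 : 0 < c := by positivity
  have ha0 : 0 < a := by rw [ha]; positivity
  have hac : 4 * a = (4 * d + 13) * c := by rw [ha, hcdef]; ring
  have hcρ : c * ρ ^ 2 = 4 * M := by rw [hcdef]; field_simp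
  set Q : Esp d × ℝ → ℝ := fun q => c * sqDist m yt q + A * hyperDist m e yt ey q
        - a * hyperDist m e yt ey q ^ 2 with hQ
  set k : Esp d × ℝ → ℝ := fun q => 1 - lam * (q.2 - yt) with hk
  have hsd := continuous_sqDist m yt
  have hhd := continuous_hyperDist m e yt ey
  have hEcl : IsClosed E :=
    (isClosed_le hsd continuous_const).inter
      ((isClosed_le continuous_const continuous_snd).inter (isClosed_le continuous_const hhd))
  have hEc : IsCompact E := isCompact_of_sqDist_le hρ.le hEcl fun q hq => hq.1
  have hsρ : ∀ q ∈ E, hyperDist m e yt ey q ≤ ρ := fun q hq =>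
    (abs_le_of_sq_le_sq' ((hyperDist_sq_le he q).trans hq.1) hρ.le).2
  have hQE : ∀ q ∈ E, c * sqDist m yt q + A / 2 * hyperDist m e yt ey q ≤ Q q := by
    intro q hq
    have h1 := hsρ q hq
    have h2 := hq.2.2
    simp only [hQ]
    nlinarith [mul_le_mul_of_nonneg_left h1 (mul_nonneg ha0.le h2)]
  have hsd0 : ∀ q : Esp d × ℝ, 0 ≤ sqDist m yt q := fun q => by unfold sqDist; positivity
  have hA0 : 0 < A := lt_of_lt_of_le (by positivity) hA
  have hQ0 : ∀ q ∈ E, 0 ≤ Q q := fun q hq => by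
    have := hQE q hq
    have h1 := mul_nonneg hc0.le (hsd0 q)
    have h2 := mul_nonneg hA0.le hq.2.2
    linarith
  have hτ : ∀ q ∈ E, |q.2 - yt| ≤ ρ := fun q hq => by
    refine abs_le_of_sq_le_sq ?_ hρ.le
    have := hq.1
    unfold sqDist at this
    nlinarith [sq_nonneg ‖q.1 - m‖]
  have hkE : ∀ q ∈ E, 1 / 2 ≤ k q := fun q hq => by
    have h1 := le_abs_self (q.2 - yt)
    have h2 := mul_le_mul_of_nonneg_left (h1.trans (hτ q hq)) hlam.le
    simp only [hk]
    linarith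
  have hQc : Continuous Q := by simp only [hQ]; fun_prop
  have hkc : Continuous k := by simp only [hk]; fun_prop
  have hfc : ContinuousOn (fun q => (W q - Q q * k q) / k q) E :=
    (hc.sub (hQc.mul hkc).continuousOn).div hkc.continuousOn
      fun q hq => by linarith [hkE q hq]
  obtain ⟨p, hpE, hpmax⟩ := hEc.exists_isMaxOn ⟨q, hq, hq0, hqs⟩ hfc
  set g := (W p - Q p * k p) / k p with hg
  have hkp := hkE p hpE
  have hWp : W p = (Q p + g) * k p := by rw [hg]; field_simp; ring
  have hle : ∀ q ∈ E, W q ≤ (Q q + g) * k q := by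
    intro q hq
    have h1 : (W q - Q q * k q) / k q ≤ g := hpmax hq
    rw [div_le_iff₀ (by linarith [hkE q hq])] at h1
    linarith
  by_cases hgpos : g ≤ 0
  · have h1 := hle q ⟨hq, hq0, hqs⟩
    have h2 := hkE q ⟨hq, hq0, hqs⟩
    change W q ≤ Q q * k q
    nlinarith
  exfalso
  push Not at hgpos
  have hQp := hQ0 p hpE
  have hWpos : 0 < W p := by rw [hWp]; positivity
  have hs_pos : 0 < hyperDist m e yt ey p := by
    refine lt_of_le_of_ne hpE.2.2 fun h => ?_
    linarith [h0 p hpE.1 hpE.2.1 h.symm]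
  have hr_lt : sqDist m yt p < ρ ^ 2 := by
    refine lt_of_le_of_ne hpE.1 fun h => ?_
    have h1 := hW p hpE.1 hpE.2.1 hpE.2.2
    have h2 := hQE p hpE
    rw [h, hcρ] at h2
    have h3 : 0 < A / 2 * hyperDist m e yt ey p := by positivity
    have : 4 * M < Q p + g := by linarith
    nlinarith
  set G : Esp d × ℝ → ℝ := fun q => (Q q + g) * k q - W q with hG
  have hGp : G p = 0 := by simp only [hG]; rw [hWp]; ring
  have hGE : ∀ q ∈ E, 0 ≤ G q := fun q hq => by simp only [hG]; linarith [hle q hq]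
  rcases hpE.2.1.eq_or_lt with hy | hy
  · obtain ⟨x, y⟩ := p
    obtain rfl : (0 : ℝ) = y := hy
    obtain ⟨rfl, D, hD, hDle⟩ := hbot x hr_lt hs_pos
    have hytρ : yt ≤ ρ := by
      have := hτ _ hpE
      simpa [abs_of_nonneg hyt] using this
    have hk1 : k (x, 0) = 1 + lam * yt := by simp only [hk]; ring
    have hk2 : 1 ≤ k (x, 0) ∧ k (x, 0) ≤ 3 / 2 := by
      rw [hk1]
      constructor
      · nlinarith
      · nlinarith [mul_le_mul_of_nonneg_left hytρ hlam.le]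
    have hder : HasDerivAt (fun t => (Q (x, t) + g) * k (x, t))
        (2 * c * (0 - yt) * k (x, 0) + (Q (x, 0) + g) * (-lam)) 0 := by
      have h1 : HasDerivAt (fun t => Q (x, t) + g) (2 * c * (0 - yt)) 0 := by
        have h2 := ((((hasDerivAt_id (0 : ℝ)).sub_const yt).pow 2).const_mul c).add_const
          (c * ‖x - m‖ ^ 2 + A * ⟪x - m, e⟫ - a * ⟪x - m, e⟫ ^ 2 + g)
        convert! h2 using 1
        · ext t
          simp [hQ, sqDist, hyperDist]
          ring
        · simp
          ring
      have h3 : HasDerivAt (fun t => k (x, t)) (-lam) 0 := by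
        have h2 := (((hasDerivAt_id (0 : ℝ)).sub_const yt).const_mul lam).const_sub 1
        convert! h2 using 1
        simp
      exact h1.mul h3
    have hGd : NormalDeriv d G x
        (2 * c * (0 - yt) * k (x, 0) + (Q (x, 0) + g) * (-lam) - D) :=
      (NormalDeriv.of_hasDerivAt hder).sub hD
    have hneg : 2 * c * (0 - yt) * k (x, 0) + (Q (x, 0) + g) * (-lam) - D < 0 := by
      have hQg : 0 < Q (x, 0) + g := by positivity
      have hWge : Q (x, 0) + g ≤ W (x, 0) := by rw [hWp]; nlinarith
      have hWle : W (x, 0) ≤ 3 / 2 * (Q (x, 0) + g) := by rw [hWp]; nlinarith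
      have h1 := hQE _ hpE
      have h2 := mul_nonneg hc0.le (hsd0 (x, 0))
      have h3 := hDle (by linarith)
      have h4 : 0 ≤ c * yt * k (x, 0) := by
        have : 0 ≤ k (x, 0) := by linarith
        positivity
      have h5 := mul_le_mul_of_nonneg_left hWle hlam.le
      have h6 := mul_pos hlam hQg
      nlinarith
    have hev : ∀ᶠ t in 𝓝[>] (0 : ℝ), (x, t) ∈ E := by
      have hcont : Continuous fun t : ℝ => ((x, t) : Esp d × ℝ) := by fun_prop
      have h1 : ∀ᶠ t in 𝓝 (0 : ℝ), sqDist m yt (x, t) < ρ ^ 2 :=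
        (hsd.comp hcont).continuousAt.eventually_lt_const hr_lt
      have h2 : ∀ᶠ t in 𝓝 (0 : ℝ), 0 < hyperDist m e yt 0 (x, t) :=
        (hhd.comp hcont).continuousAt.eventually_const_lt hs_pos
      filter_upwards [nhdsWithin_le_nhds h1, nhdsWithin_le_nhds h2, self_mem_nhdsWithin]
        with t h1 h2 h3
      exact ⟨h1.le, (le_of_lt h3 : (0 : ℝ) ≤ t), h2.le⟩
    obtain ⟨t, ht1, ht2⟩ := ((hGd.eventually_lt hneg).and hev).exists
    linarith [hGE _ ht2]
  · have hL := (hasLaplacian_quadratic_mul_affine (m := m) (yt := yt) he c A a g lam p).sub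
      (hlap p hr_lt hy hs_pos)
    refine hL.not_isLocalMin ?_ ?_
    · have h1 : lam * (-(p.2 - yt)) ≤ 1 / 2 * 1 := by
        have := mul_le_mul_of_nonneg_left ((neg_le_abs (p.2 - yt)).trans (hτ p hpE)) hlam.le
        linarith
      have h2 : 0 ≤ A - 2 * a * hyperDist m e yt ey p := by
        have := mul_le_mul_of_nonneg_left (hsρ p hpE) ha0.le
        linarith
      have h3 := mul_nonneg hlam.le (mul_nonneg hey h2)
      have h4 : 2 * c * (d + 1) - 2 * a = -(9 / 2) * c := by linarith
      have h5 := mul_le_mul_of_nonneg_left h1 hc0.le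
      have h6 : 1 / 2 ≤ 1 - lam * (p.2 - yt) := hkp
      have h7 := mul_le_mul_of_nonneg_left h6 hc0.le
      rw [h4]
      nlinarith
    · have : E ∈ 𝓝 p := by
        filter_upwards [hsd.continuousAt.eventually_lt_const hr_lt,
          continuous_snd.continuousAt.eventually_const_lt hy,
          hhd.continuousAt.eventually_const_lt hs_pos] with q h1 h2 h3
        exact ⟨h1.le, h2.le, h3.le⟩
      filter_upwards [this] with q hq
      change G p ≤ G q
      rw [hGp]
      exact hGE q hq

/-- Minimum principle: a continuous function on a compact set is nonnegative if it cannot attain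
a negative minimum, either because of a negative Laplacian in the interior or because of a
negative normal derivative on the flat part of the boundary. -/
theorem nonneg_of_min_principle {d : ℕ} {G : Esp d × ℝ → ℝ} {E : Set (Esp d × ℝ)}
    (hE : IsCompact E) (hG : ContinuousOn G E)
    (h : ∀ p ∈ E, G p < 0 → (E ∈ 𝓝 p ∧ ∃ l < 0, HasLaplacian G p l) ∨
      (p.2 = 0 ∧ (∀ᶠ t in 𝓝[>] (0 : ℝ), (p.1, t) ∈ E) ∧ ∃ D < 0, NormalDeriv d G p.1 D)) :
    ∀ q ∈ E, 0 ≤ G q := by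
  intro q hq
  obtain ⟨p, hp, hmin⟩ := hE.exists_isMinOn ⟨q, hq⟩ hG
  by_contra! hneg
  have hp0 : G p < 0 := (hmin hq).trans_lt hneg
  rcases h p hp hp0 with ⟨h1, l, hl, hL⟩ | ⟨h1, h2, D, hD, hN⟩
  · exact hL.not_isLocalMin hl (hmin.isLocalMin h1)
  · obtain ⟨t, ht1, ht2⟩ := ((hN.eventually_lt hD).and h2).exists
    have h3 : G p ≤ G (p.1, t) := hmin ht2
    have h4 : p = (p.1, 0) := Prod.ext rfl h1
    rw [h4] at h3
    exact absurd ht1 (not_lt.2 h3)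

theorem nonneg_on_cylinder {d : ℕ} {G : Esp d × ℝ → ℝ} {m : Esp d} {ρ η : ℝ} (hη : 0 < η)
    (hG : ContinuousOn G {q | ‖q.1 - m‖ ≤ ρ ∧ 0 ≤ q.2 ∧ q.2 ≤ η})
    (hside : ∀ q : Esp d × ℝ, ‖q.1 - m‖ = ρ → 0 ≤ q.2 → q.2 ≤ η → 0 ≤ G q)
    (htop : ∀ x : Esp d, ‖x - m‖ ≤ ρ → 0 ≤ G (x, η))
    (hlap : ∀ q : Esp d × ℝ, ‖q.1 - m‖ < ρ → 0 < q.2 → q.2 < η → ∃ l < 0, HasLaplacian G q l)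
    (hbot : ∀ x : Esp d, ‖x - m‖ < ρ → G (x, 0) < 0 → ∃ D < 0, NormalDeriv d G x D)
    {q : Esp d × ℝ} (h1 : ‖q.1 - m‖ ≤ ρ) (h2 : 0 ≤ q.2) (h3 : q.2 ≤ η) : 0 ≤ G q := by
  have hcont : Continuous fun q : Esp d × ℝ => ‖q.1 - m‖ := by fun_prop
  refine nonneg_of_min_principle (E := {q | ‖q.1 - m‖ ≤ ρ ∧ 0 ≤ q.2 ∧ q.2 ≤ η}) ?_ hG ?_ q
    ⟨h1, h2, h3⟩
  · have : {q : Esp d × ℝ | ‖q.1 - m‖ ≤ ρ ∧ 0 ≤ q.2 ∧ q.2 ≤ η}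
        = Metric.closedBall m ρ ×ˢ Icc 0 η := by
      ext q
      simp [dist_eq_norm]
    rw [this]
    exact (isCompact_closedBall m ρ).prod isCompact_Icc
  rintro ⟨x, y⟩ ⟨hx, hy, hyη⟩ hneg
  have hx' : ‖x - m‖ < ρ := lt_of_le_of_ne hx fun h => (hside (x, y) h hy hyη).not_gt hneg
  have hy' : y < η := lt_of_le_of_ne hyη fun h => by
    have h : y = η := h
    subst h
    exact (htop x hx).not_gt hneg
  rcases (show 0 ≤ y from hy).eq_or_lt with rfl | h0
  · right
    refine ⟨rfl, ?_, hbot x hx' hneg⟩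
    filter_upwards [self_mem_nhdsWithin, nhdsWithin_le_nhds (eventually_lt_nhds hη)]
      with t ht ht'
    exact ⟨hx, le_of_lt ht, ht'.le⟩
  · left
    refine ⟨?_, hlap (x, y) hx' h0 hy'⟩
    filter_upwards [hcont.continuousAt.eventually_lt_const hx',
      continuous_snd.continuousAt.eventually_const_lt h0,
      continuous_snd.continuousAt.eventually_lt_const hy'] with q h1 h2 h3
    exact ⟨h1.le, h2.le, h3.le⟩

/-- Reflection of `ℝ^d` across the hyperplane through `m` orthogonal to the unit vector `e`. -/
noncomputable def reflAt {d : ℕ} (m e x : Esp d) : Esp d := x - (2 * ⟪x - m, e⟫) • e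

section reflAt

variable {d : ℕ} {m e : Esp d}

theorem reflAt_eq (he : ‖e‖ = 1) (x : Esp d) :
    reflAt m e x = (m - (ℝ ∙ e)ᗮ.reflection m) + (ℝ ∙ e)ᗮ.reflection x := by
  have h : ∀ z, (ℝ ∙ e)ᗮ.reflection z = z - (2 * ⟪z, e⟫) • e := by
    intro z
    rw [Submodule.reflection_orthogonal_apply, Submodule.reflection_singleton_apply, he,
      real_inner_comm]
    simp [two_smul, ← add_smul, two_mul]
  simp only [reflAt, h, inner_sub_left, mul_sub, sub_smul]
  abel

theorem norm_reflAt_sub (he : ‖e‖ = 1) (x : Esp d) : ‖reflAt m e x - m‖ = ‖x - m‖ := by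
  rw [reflAt_eq he, ← (ℝ ∙ e)ᗮ.reflection.norm_map (x - m), map_sub]
  congr 1
  abel

theorem norm_sub_reflAt (he : ‖e‖ = 1) {x : Esp d} (hx : 0 ≤ ⟪x - m, e⟫) :
    ‖x - reflAt m e x‖ = 2 * ⟪x - m, e⟫ := by
  rw [reflAt, sub_sub_cancel, norm_smul, he, Real.norm_eq_abs, abs_of_nonneg (by linarith),
    mul_one]

theorem reflAt_add_smul (he : ‖e‖ = 1) (s : ℝ) : reflAt m e (m + s • e) = m - s • e := by
  rw [reflAt, add_sub_cancel_left, real_inner_smul_left, real_inner_self_eq_norm_sq, he]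
  module

theorem continuous_reflAt : Continuous (reflAt m e) := by
  unfold reflAt
  fun_prop

theorem HasLaplacian.comp_reflAt (he : ‖e‖ = 1) {v : Esp d × ℝ → ℝ} {p : Esp d × ℝ} {l : ℝ}
    (hv : HasLaplacian v (reflAt m e p.1, p.2) l) :
    HasLaplacian (fun q => v (reflAt m e q.1, q.2)) p l := by
  rw [reflAt_eq he] at hv
  exact (hv.comp_isometry (ℝ ∙ e)ᗮ.reflection _).congr (fun q => by rw [reflAt_eq he]) rfl

end reflAt

theorem exists_midpoint_direction {d : ℕ} {x x' : Esp d} (hne : x ≠ x') :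
    ∃ e : Esp d, ‖e‖ = 1 ∧ x = (1 / 2 : ℝ) • (x + x') + (‖x - x'‖ / 2) • e ∧
      x' = (1 / 2 : ℝ) • (x + x') - (‖x - x'‖ / 2) • e := by
  have hn : 0 < ‖x - x'‖ := norm_pos_iff.2 (sub_ne_zero.2 hne)
  have hse : (‖x - x'‖ / 2) • ((1 / ‖x - x'‖) • (x - x')) = (1 / 2 : ℝ) • (x - x') := by
    rw [smul_smul]
    congr 1
    field_simp
  refine ⟨(1 / ‖x - x'‖) • (x - x'), ?_, ?_, ?_⟩
  · rw [norm_smul, Real.norm_eq_abs, abs_of_pos (by positivity)]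
    field_simp
  · rw [hse]; module
  · rw [hse]; module

/-- Tangential Lipschitz estimate for harmonic functions on a half-ball whose normal derivative
on the flat boundary satisfies a one-sided monotonicity condition. -/
theorem tangential_lipschitz {d : ℕ} {v : Esp d × ℝ → ℝ} {F : Esp d → ℝ} {x x' m : Esp d}
    {yt ρ M Λ P : ℝ} (hm : m = (1 / 2 : ℝ) • (x + x')) (hyt : 0 ≤ yt) (hρ : 0 < ρ)
    (hΛ : 0 < Λ) (hΛρ : 8 * Λ * ρ ≤ 1) (hM : 0 < M) (hP : 0 ≤ P)
    (hc : ContinuousOn v {q | sqDist m yt q ≤ ρ ^ 2 ∧ 0 ≤ q.2})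
    (hv : ∀ q, sqDist m yt q ≤ ρ ^ 2 → 0 ≤ q.2 → |v q| ≤ M)
    (hlap : ∀ q, sqDist m yt q < ρ ^ 2 → 0 < q.2 → HasLaplacian v q 0)
    (hF : ∀ z, sqDist m yt (z, 0) < ρ ^ 2 → NormalDeriv d v z (F z))
    (hmono : ∀ z z', sqDist m yt (z, 0) < ρ ^ 2 → sqDist m yt (z', 0) < ρ ^ 2 →
      P * ‖z - z'‖ < v (z, 0) - v (z', 0) →
      -(2 * Λ) * (v (z, 0) - v (z', 0)) ≤ F z - F z')
    (hx : ‖x - x'‖ ≤ 2 * ρ) :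
    v (x, yt) - v (x', yt) ≤ ((4 * d + 13) * M / ρ + 2 * P) * ‖x - x'‖ := by
  rcases eq_or_ne x x' with rfl | hne
  · simp
  have hn : 0 < ‖x - x'‖ := norm_pos_iff.2 (sub_ne_zero.2 hne)
  obtain ⟨e, he, hxe, hxe'⟩ := exists_midpoint_direction hne
  rw [← hm] at hxe hxe'
  set s := ‖x - x'‖ / 2 with hs
  have hsq : ∀ q, sqDist m yt (reflAt m e q.1, q.2) = sqDist m yt q := fun q => by
    simp only [sqDist, norm_reflAt_sub he]
  have hhyp : ∀ q, hyperDist m e yt 0 q = ⟪q.1 - m, e⟫ := fun q => by simp [hyperDist]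
  set a := (4 * d + 13) * M / ρ ^ 2 with ha
  set A := 2 * a * ρ + 4 * P with hA
  have key := le_quadratic_barrier (W := fun q => v q - v (reflAt m e q.1, q.2)) (m := m)
    (e := e) (yt := yt) (ρ := ρ) (ey := 0) (lam := 4 * Λ) (M := M) (a := a) (A := A)
    (by rw [he]; norm_num) le_rfl hyt hρ (by positivity) (by linarith) hM ha
    (by rw [hA]; linarith) ?_ ?_ ?_ ?_ ?_ (x, yt) ?_ hyt ?_
  · rw [hhyp] at key
    simp only [sqDist] at key
    rw [hxe] at key
    simp only [reflAt_add_smul he, add_sub_cancel_left, sub_self, mul_zero, sub_zero,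
      mul_one, norm_smul, he, real_inner_smul_left, real_inner_self_eq_norm_sq] at key
    rw [← hxe, ← hxe'] at key
    have h1 : 4 * M / ρ ^ 2 ≤ a := by
      rw [ha]
      gcongr
      have : (0 : ℝ) ≤ d := Nat.cast_nonneg d
      linarith
    have h2 : |s| = s := abs_of_nonneg (by positivity)
    rw [Real.norm_eq_abs, h2] at key
    have h3 := mul_le_mul_of_nonneg_right h1 (sq_nonneg s)
    have h4 : ((4 * d + 13) * M / ρ + 2 * P) * ‖x - x'‖ = A * s := by
      rw [hA, ha, hs]
      field_simp
      ring
    rw [h4]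
    have h5 : (4 * M / ρ ^ 2 * (s ^ 2 + 0 ^ 2) + A * (s * 1 ^ 2) - a * (s * 1 ^ 2) ^ 2)
      = 4 * M / ρ ^ 2 * s ^ 2 + A * s - a * s ^ 2 := by ring
    simp only [mul_one, one_pow, ne_eq, OfNat.ofNat_ne_zero, not_false_eq_true, zero_pow,
      add_zero] at key
    linarith
  · refine (hc.mono fun q hq => ⟨hq.1, hq.2.1⟩).sub
      (hc.comp (f := fun q : Esp d × ℝ => (reflAt m e q.1, q.2)) ?_ fun q hq => ?_)
    · exact ((continuous_reflAt.comp continuous_fst).prodMk continuous_snd).continuousOn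
    · exact ⟨(hsq q).trans_le hq.1, hq.2.1⟩
  · intro q h1 h2 _
    have h3 := abs_le.1 (hv q h1 h2)
    have h4 := abs_le.1 (hv (reflAt m e q.1, q.2) ((hsq q).trans_le h1) h2)
    linarith [h3.2, h4.1]
  · intro q _ _ h
    rw [hhyp] at h
    have : reflAt m e q.1 = q.1 := by simp [reflAt, h]
    simp [this]
  · intro q h1 h2 _
    exact ((hlap q h1 h2).sub ((hlap (reflAt m e q.1, q.2) ((hsq q).trans_lt h1) h2).comp_reflAt
      he)).congr (fun _ => rfl) (by ring)
  · intro z h1 h2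
    rw [hhyp] at h2 ⊢
    have h3 : sqDist m yt (reflAt m e z, 0) < ρ ^ 2 := (hsq (z, 0)).trans_lt h1
    refine ⟨rfl, F z - F (reflAt m e z), (hF z h1).sub (hF _ h3), fun h => ?_⟩
    have h4 : ‖z - reflAt m e z‖ = 2 * ⟪z - m, e⟫ := norm_sub_reflAt he h2.le
    have ha0 : 0 < a := by positivity
    have h5 : P * ‖z - reflAt m e z‖ < v (z, 0) - v (reflAt m e z, 0) := by
      refine lt_of_le_of_lt ?_ h
      rw [h4, hA]
      have : 0 ≤ a * ρ * ⟪z - m, e⟫ := by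
        have : (0 : ℝ) < ⟪z - m, e⟫ := h2
        positivity
      simp only
      linarith
    have := hmono z _ h1 h3 h5
    simp only
    linarith
  · rw [hxe]
    simp only [sqDist, add_sub_cancel_left, norm_smul, he, sub_self, Real.norm_eq_abs, mul_one,
      sq_abs]
    have : s ≤ ρ := by rw [hs]; linarith
    have hs0 : 0 ≤ s := by positivity
    nlinarith
  · rw [hhyp, hxe]
    simp only [add_sub_cancel_left, real_inner_smul_left, real_inner_self_eq_norm_sq, he]
    positivity

/-- Vertical Lipschitz estimate for harmonic functions in a ball. -/
theorem vertical_lipschitz {d : ℕ} {v : Esp d × ℝ → ℝ} {x : Esp d} {yt ρ M s : ℝ}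
    (hρ : 0 < ρ) (hρy : ρ ≤ yt) (hM : 0 < M)
    (hc : ContinuousOn v {q | sqDist x yt q ≤ ρ ^ 2 ∧ 0 ≤ q.2})
    (hv : ∀ q, sqDist x yt q ≤ ρ ^ 2 → 0 ≤ q.2 → |v q| ≤ M)
    (hlap : ∀ q, sqDist x yt q < ρ ^ 2 → 0 < q.2 → HasLaplacian v q 0)
    (hs : 0 ≤ s) (hsρ : s ≤ ρ) :
    v (x, yt + s) - v (x, yt - s) ≤ (8 * d + 26) * M / ρ * s := by
  have hhyp : ∀ q, hyperDist x 0 yt 1 q = q.2 - yt := fun q => by simp [hyperDist]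
  have hsq : ∀ q : Esp d × ℝ, sqDist x yt (q.1, 2 * yt - q.2) = sqDist x yt q := fun q => by
    simp only [sqDist]; ring
  have hτ : ∀ q : Esp d × ℝ, sqDist x yt q ≤ ρ ^ 2 → q.2 - yt ≤ ρ := fun q hq => by
    refine (abs_le_of_sq_le_sq' ?_ hρ.le).2
    have := hq
    unfold sqDist at this
    nlinarith [sq_nonneg ‖q.1 - x‖]
  have hτ' : ∀ q : Esp d × ℝ, sqDist x yt q < ρ ^ 2 → q.2 - yt < ρ := fun q hq => by
    refine (abs_lt_of_sq_lt_sq' ?_ hρ.le).2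
    have := hq
    unfold sqDist at this
    nlinarith [sq_nonneg ‖q.1 - x‖]
  set a := (4 * d + 13) * M / ρ ^ 2 with ha
  have key := le_quadratic_barrier (W := fun q => v q - v (q.1, 2 * yt - q.2)) (m := x)
    (e := 0) (yt := yt) (ρ := ρ) (ey := 1) (lam := 1 / (2 * ρ)) (M := M) (a := a)
    (A := 2 * a * ρ)
    (by simp) zero_le_one (by linarith) hρ (by positivity) (by field_simp; norm_num) hM ha
    le_rfl ?_ ?_ ?_ ?_ ?_ (x, yt + s) ?_ (by simp only; linarith) ?_
  · rw [hhyp] at key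
    simp only [sqDist, sub_self, norm_zero, add_sub_cancel_left] at key
    have h1 : 4 * M / ρ ^ 2 ≤ a := by
      rw [ha]
      gcongr
      have : (0 : ℝ) ≤ d := Nat.cast_nonneg d
      linarith
    have h3 := mul_le_mul_of_nonneg_right h1 (sq_nonneg s)
    have h4 : (8 * d + 26) * M / ρ * s = 2 * a * ρ * s := by
      rw [ha]
      field_simp
      ring
    rw [h4]
    have h5 : 2 * yt - (yt + s) = yt - s := by ring
    rw [h5] at key
    have ha0 : 0 < a := by positivity
    have h6 : 0 ≤ 1 / (2 * ρ) * s := by positivity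
    have h7 : 1 / (2 * ρ) * s ≤ 1 / 2 := by
      rw [div_mul_eq_mul_div, div_le_div_iff₀ (by positivity) (by positivity)]
      linarith
    refine key.trans ?_
    have h8 : 0 ≤ 2 * a * ρ * s := by positivity
    have h9 : 4 * M / ρ ^ 2 * (0 ^ 2 + s ^ 2) + 2 * a * ρ * s - a * s ^ 2 ≤ 2 * a * ρ * s := by
      linarith
    have h10 : 0 ≤ 1 - 1 / (2 * ρ) * s := by linarith
    refine (mul_le_mul_of_nonneg_right h9 h10).trans ?_
    nlinarith
  · refine (hc.mono fun q hq => ⟨hq.1, hq.2.1⟩).sub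
      (hc.comp (f := fun q : Esp d × ℝ => (q.1, 2 * yt - q.2)) ?_ fun q hq => ?_)
    · exact Continuous.continuousOn (by fun_prop)
    · exact ⟨(hsq q).trans_le hq.1, by have := hτ q hq.1; simp only; linarith⟩
  · intro q h1 h2 _
    have h3 := abs_le.1 (hv q h1 h2)
    have h4 := abs_le.1 (hv (q.1, 2 * yt - q.2) ((hsq q).trans_le h1)
      (by have := hτ q h1; simp only; linarith))
    linarith [h3.2, h4.1]
  · intro q _ _ h
    rw [hhyp] at h
    have : (q.1, 2 * yt - q.2) = q := Prod.ext rfl (by simp only; linarith)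
    simp [this]
  · intro q h1 h2 _
    have h3 := hlap (q.1, 2 * yt - q.2) ((hsq q).trans_lt h1)
      (by have := hτ' q h1; simp only; linarith)
    exact ((hlap q h1 h2).sub (h3.comp_snd_reflect _)).congr (fun _ => rfl) (by ring)
  · intro z _ h2
    rw [hhyp] at h2
    simp only at h2
    linarith
  · simp only [sqDist, sub_self, norm_zero, add_sub_cancel_left]
    nlinarith
  · rw [hhyp]
    simpa using hs

/-- The quadratic barrier with Laplacian `-2 * A` and normal derivative `B` on `{y = 0}`. -/
noncomputable def quadBarrier {d : ℕ} (m : Esp d) (c A B : ℝ) (ℓ : Esp d →L[ℝ] ℝ)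
    (q : Esp d × ℝ) : ℝ :=
  c + ℓ q.1 + A * (‖q.1 - m‖ ^ 2 - (d + 1) * q.2 ^ 2) + B * q.2

section quadBarrier

variable {d : ℕ} {m : Esp d} {c A B : ℝ} {ℓ : Esp d →L[ℝ] ℝ}

theorem continuous_quadBarrier : Continuous (quadBarrier m c A B ℓ) := by
  unfold quadBarrier
  fun_prop

theorem hasLaplacian_quadBarrier (q : Esp d × ℝ) :
    HasLaplacian (quadBarrier m c A B ℓ) q (-2 * A) := by
  have h := (((HasLaplacian.const c).add (HasLaplacian.clm ℓ)).add
    (((HasLaplacian.norm_sub_sq m).sub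
      ((HasLaplacian.snd_sub_sq (p := q) 0).const_mul (d + 1))).const_mul A)).add
    (HasLaplacian.snd.const_mul B)
  exact h.congr (fun q => by simp [quadBarrier]) (by ring)

theorem normalDeriv_quadBarrier (x : Esp d) : NormalDeriv d (quadBarrier m c A B ℓ) x B := by
  refine .of_hasDerivAt ?_
  have h1 := (((hasDerivAt_pow 2 (0 : ℝ)).const_mul (-A * (d + 1))).add
    ((hasDerivAt_id (0 : ℝ)).const_mul B)).const_add (c + ℓ x + A * ‖x - m‖ ^ 2)
  convert! h1 using 1
  · ext t
    simp [quadBarrier]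
    ring
  · simp

theorem quadBarrier_le_on_cylinder {v : Esp d × ℝ → ℝ} {ρ η : ℝ} (hA : A < 0) (hη : 0 < η)
    (hc : ContinuousOn v {q | ‖q.1 - m‖ ≤ ρ ∧ 0 ≤ q.2 ∧ q.2 ≤ η})
    (hlap : ∀ q : Esp d × ℝ, ‖q.1 - m‖ < ρ → 0 < q.2 → q.2 < η → HasLaplacian v q 0)
    (hside : ∀ q : Esp d × ℝ, ‖q.1 - m‖ = ρ → 0 ≤ q.2 → q.2 ≤ η →
      quadBarrier m c A B ℓ q ≤ v q)
    (htop : ∀ x : Esp d, ‖x - m‖ ≤ ρ → quadBarrier m c A B ℓ (x, η) ≤ v (x, η))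
    (hbot : ∀ x : Esp d, ‖x - m‖ < ρ → v (x, 0) < quadBarrier m c A B ℓ (x, 0) →
      ∃ D < B, NormalDeriv d v x D)
    {q : Esp d × ℝ} (h1 : ‖q.1 - m‖ ≤ ρ) (h2 : 0 ≤ q.2) (h3 : q.2 ≤ η) :
    quadBarrier m c A B ℓ q ≤ v q := by
  rw [← sub_nonneg]
  refine nonneg_on_cylinder (G := fun q => v q - quadBarrier m c A B ℓ q) hη
    (hc.sub continuous_quadBarrier.continuousOn) ?_ ?_ ?_ ?_ h1 h2 h3
  · exact fun q h1 h2 h3 => sub_nonneg.2 (hside q h1 h2 h3)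
  · exact fun x hx => sub_nonneg.2 (htop x hx)
  · exact fun q h1 h2 h3 => ⟨0 - (-2 * A), by linarith,
      (hlap q h1 h2 h3).sub (hasLaplacian_quadBarrier q)⟩
  · intro x hx hneg
    obtain ⟨D, hD, hN⟩ := hbot x hx (sub_neg.1 hneg)
    exact ⟨D - B, by linarith, hN.sub (normalDeriv_quadBarrier x)⟩

end quadBarrier

/-- A normalized solution of the thin two-phase problem on the cylinder of radius and height one:
`F` is the normal derivative, the obstacle `ψ` has slope and curvature at most `e`, and the
nonlinearity has size `θ` and Lipschitz constant `Λ`. -/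
structure ThinSol {d : ℕ} (v : Esp d × ℝ → ℝ) (ψ F : Esp d → ℝ) (ℓ : Esp d → Esp d →L[ℝ] ℝ)
    (e Λ θ : ℝ) : Prop where
  cont : ContinuousOn v {q | ‖q.1‖ < 1 ∧ 0 ≤ q.2 ∧ q.2 < 1}
  lap : ∀ q : Esp d × ℝ, ‖q.1‖ < 1 → 0 < q.2 → q.2 < 1 → HasLaplacian v q 0
  flux : ∀ x, ‖x‖ < 1 → NormalDeriv d v x (F x)
  flux_pos : ∀ x, ‖x‖ < 1 → ψ x < v (x, 0) → θ - Λ * (v (x, 0) - ψ x) ≤ F x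
  flux_neg : ∀ x, ‖x‖ < 1 → v (x, 0) < ψ x → F x ≤ -θ + Λ * (ψ x - v (x, 0))
  flux_mono : ∀ x x', ‖x‖ < 1 → ‖x'‖ < 1 → v (x', 0) - ψ x' < v (x, 0) - ψ x →
    -Λ * ((v (x, 0) - ψ x) - (v (x', 0) - ψ x')) ≤ F x - F x'
  obst_lip : ∀ x x', ‖x‖ < 1 → ‖x'‖ < 1 → |ψ x - ψ x'| ≤ e * ‖x - x'‖
  obst_grad : ∀ x, ‖x‖ < 1 → ‖ℓ x‖ ≤ e
  obst_taylor : ∀ x x', ‖x‖ < 1 → ‖x'‖ < 1 →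
    |ψ x' - ψ x - ℓ x (x' - x)| ≤ e * ‖x' - x‖ ^ 2

/-- `v` is `K`-Lipschitz in the horizontal directions on the cylinder of size `r`. -/
def LipX {d : ℕ} (K : ℝ) (v : Esp d × ℝ → ℝ) (r : ℝ) : Prop :=
  ∀ x x' : Esp d, ∀ y : ℝ, ‖x‖ < r → ‖x'‖ < r → 0 ≤ y → y < r →
    v (x, y) - v (x', y) ≤ K * ‖x - x'‖

theorem LipX.neg {d : ℕ} {K r : ℝ} {v : Esp d × ℝ → ℝ} (h : LipX K v r) :
    LipX K (fun q => -v q) r := by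
  intro x x' y h1 h2 h3 h4
  have := h x' x y h2 h1 h3 h4
  rw [norm_sub_rev] at this
  linarith

theorem LipX.mono {d : ℕ} {K K' r : ℝ} {v : Esp d × ℝ → ℝ} (h : LipX K v r) (hK : K ≤ K') :
    LipX K' v r := fun x x' y h1 h2 h3 h4 =>
  (h x x' y h1 h2 h3 h4).trans (mul_le_mul_of_nonneg_right hK (norm_nonneg _))

namespace ThinSol

variable {d : ℕ} {v : Esp d × ℝ → ℝ} {ψ F : Esp d → ℝ} {ℓ : Esp d → Esp d →L[ℝ] ℝ}
  {e Λ θ K : ℝ}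

theorem neg (h : ThinSol v ψ F ℓ e Λ θ) :
    ThinSol (fun q => -v q) (fun x => -ψ x) (fun x => -F x) (fun x => -ℓ x) e Λ θ where
  cont := h.cont.neg
  lap q h1 h2 h3 := ((h.lap q h1 h2 h3).const_mul (-1)).congr (fun q => by ring) (by ring)
  flux x hx := by
    have := (h.flux x hx).const_mul (-1)
    simpa using this
  flux_pos x hx hlt := by
    have := h.flux_neg x hx (by linarith)
    linarith
  flux_neg x hx hlt := by
    have := h.flux_pos x hx (by linarith)
    linarith
  flux_mono x x' hx hx' hlt := by
    have := h.flux_mono x' x hx' hx (by linarith)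
    linarith
  obst_lip x x' hx hx' := by
    rw [← abs_neg]
    convert h.obst_lip x x' hx hx' using 2
    ring
  obst_grad x hx := by simpa using h.obst_grad x hx
  obst_taylor x x' hx hx' := by
    rw [← abs_neg]
    convert h.obst_taylor x x' hx hx' using 2
    simp
    ring

theorem obst_abs_le (h : ThinSol v ψ F ℓ e Λ θ) (h0 : ψ 0 = 0) {x : Esp d} (hx : ‖x‖ < 1) :
    |ψ x| ≤ e * ‖x‖ := by
  simpa [h0] using h.obst_lip x 0 hx (by simp)

theorem bottom_abs_le (hL : LipX K v 1) (hv0 : v (0, 0) = 0) {x : Esp d} (hx : ‖x‖ < 1) :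
    |v (x, 0)| ≤ K * ‖x‖ := by
  have h1 := hL x 0 0 hx (by simp) le_rfl one_pos
  have h2 := hL 0 x 0 (by simp) hx le_rfl one_pos
  simp only [hv0, sub_zero, zero_sub, norm_neg] at h1 h2
  exact abs_le.2 ⟨by linarith, h1⟩

/-- If the horizontal slope is small and `v(0, η) ≥ 0`, then `v` lies above the obstacle. -/
theorem obst_le_of_nonneg (h : ThinSol v ψ F ℓ e Λ θ) (hθ : 0 < θ) (hΛ : 0 ≤ Λ)
    (hK : 0 < K) (heK : e ≤ K) (hKθ : 96 * (d + 1) * K ≤ θ) (hΛK : 8 * Λ * K ≤ θ)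
    (hL : LipX K v 1) (hv0 : v (0, 0) = 0) (hψ0 : ψ 0 = 0)
    (htop : 0 ≤ v (0, 1 / (8 * (d + 1)))) {x₁ : Esp d} (hx₁ : ‖x₁‖ ≤ 1 / 4) :
    ψ x₁ ≤ v (x₁, 0) := by
  have hd : (0 : ℝ) ≤ d := Nat.cast_nonneg d
  set η : ℝ := 1 / (8 * (d + 1)) with hη
  have hη0 : 0 < η := by positivity
  have hηd : (d + 1) * η = 1 / 8 := by rw [hη]; field_simp
  have hη8 : η ≤ 1 / 8 := by nlinarith
  have hdη : (d + 1) * η ^ 2 = η / 8 := by rw [pow_two, ← mul_assoc, hηd]; ring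
  have hKη : 12 * K ≤ η * θ := by
    have := mul_le_mul_of_nonneg_left hKθ hη0.le
    have h2 : η * (96 * (d + 1) * K) = 12 * K := by
      rw [show η * (96 * (d + 1) * K) = 96 * ((d + 1) * η) * K by ring, hηd]; ring
    linarith
  have hy2 : ∀ y : ℝ, 0 ≤ y → y ≤ η → 0 ≤ (d + 1) * y ^ 2 ∧ (d + 1) * y ^ 2 ≤ η / 8 :=
    fun y h1 h2 => ⟨by positivity, by rw [← hdη]; gcongr⟩
  have hflux : ∀ x, ‖x‖ < 1 → v (x, 0) < ψ x → F x ≤ -(3 / 4) * θ := by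
    intro x hx hlt
    have h1 := h.flux_neg x hx hlt
    have h2 := (abs_le.1 (bottom_abs_le hL hv0 hx)).1
    have h3 := (abs_le.1 (h.obst_abs_le hψ0 hx)).2
    have h4 : e * ‖x‖ ≤ K * ‖x‖ := by gcongr
    have h5 : K * ‖x‖ ≤ K * 1 := by gcongr
    have h6 : Λ * (ψ x - v (x, 0)) ≤ Λ * (2 * K) := by gcongr; linarith
    linarith
  obtain ⟨y₀, hy₀, hmin⟩ := isCompact_Icc.exists_isMinOn (⟨0, le_rfl, hη0.le⟩ : (Icc 0 η).Nonempty)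
    (f := fun y => v (0, y)) (h.cont.comp (by fun_prop : Continuous fun y : ℝ => ((0 : Esp d), y)).continuousOn
      fun y hy => ⟨by simp, hy.1, by simp only; linarith [hy.2]⟩)
  have hmin' : ∀ y, 0 ≤ y → y ≤ η → v (0, y₀) ≤ v (0, y) := fun y h1 h2 => hmin ⟨h1, h2⟩
  set μ := -v (0, y₀) with hμ
  have hμ0 : 0 ≤ μ := by
    have := hmin' 0 le_rfl hη0.le
    rw [hv0] at this
    linarith
  have hlow : ∀ x y, ‖x‖ < 1 → 0 ≤ y → y ≤ η → -μ - K * ‖x‖ ≤ v (x, y) := by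
    intro x y hx h1 h2
    have h3 := hL 0 x y (by simp) hx h1 (by linarith)
    rw [zero_sub, norm_neg] at h3
    linarith [hmin' y h1 h2]
  have hμK : μ ≤ K := by
    have key := quadBarrier_le_on_cylinder (v := v) (m := 0) (ρ := 1 / 2)
      (c := -K / 2 - 4 * (μ + K) * (η / 8)) (A := -(4 * (μ + K))) (B := 0) (ℓ := 0)
      (by linarith) hη0
      (h.cont.mono fun q hq => ⟨by have := hq.1; rw [sub_zero] at this; linarith, hq.2.1,
        by linarith [hq.2.2]⟩)
      (fun q h1 h2 h3 => h.lap q (by rw [sub_zero] at h1; linarith) h2 (by linarith))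
      ?_ ?_ ?_ (q := (0, y₀)) (by simp) hy₀.1 hy₀.2
    · simp only [quadBarrier, sub_zero, norm_zero, zero_apply] at key
      have := (hy2 y₀ hy₀.1 hy₀.2).1
      have h1 := mul_nonneg (by linarith : 0 ≤ 4 * (μ + K)) this
      have h2 := mul_le_mul_of_nonneg_left hη8 (by linarith : 0 ≤ 4 * (μ + K))
      linarith
    · intro q h1 h2 h3
      rw [sub_zero] at h1
      simp only [quadBarrier, sub_zero, h1, zero_apply]
      have h4 := hlow q.1 q.2 (by linarith) h2 h3
      rw [h1] at h4
      have h5 := mul_le_mul_of_nonneg_left (hy2 q.2 h2 h3).2 (by linarith : 0 ≤ 4 * (μ + K))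
      refine le_trans ?_ h4
      linarith
    · intro x hx
      rw [sub_zero] at hx
      simp only [quadBarrier, sub_zero, hdη, zero_apply]
      have h3 := hL 0 x η (by simp) (by linarith) hη0.le (by linarith)
      rw [zero_sub, norm_neg] at h3
      have h4 : 0 ≤ K * (4 * ‖x‖ ^ 2 - ‖x‖ + 1 / 2) := by
        refine mul_nonneg hK.le ?_
        nlinarith [sq_nonneg (‖x‖ - 1 / 8)]
      have h5 := mul_nonneg hμ0 (sq_nonneg ‖x‖)
      linarith
    · intro x hx hlt
      rw [sub_zero] at hx
      refine ⟨F x, ?_, h.flux x (by linarith)⟩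
      simp only [quadBarrier, sub_zero, zero_apply] at hlt
      have h3 := (abs_le.1 (h.obst_abs_le hψ0 (by linarith : ‖x‖ < 1))).1
      have h4 : e * ‖x‖ ≤ K * ‖x‖ := by gcongr
      have h5 : 0 ≤ K * (4 * ‖x‖ ^ 2 - ‖x‖ + 1 / 2) := by
        refine mul_nonneg hK.le ?_
        nlinarith [sq_nonneg (‖x‖ - 1 / 8)]
      have h6 := mul_nonneg hμ0 (sq_nonneg ‖x‖)
      have h7 := mul_nonneg (by linarith : 0 ≤ μ + K) hη0.le
      have := hflux x (by linarith) (by linarith)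
      linarith
  have hlow2 : ∀ x y, ‖x‖ ≤ 1 / 2 → 0 ≤ y → y ≤ η → -2 * K ≤ v (x, y) := by
    intro x y hx h1 h2
    have := hlow x y (by linarith) h1 h2
    have h3 := mul_le_mul_of_nonneg_left hx hK.le
    linarith
  have hx₁' : ‖x₁‖ < 1 := by linarith
  have hψ₁ := (abs_le.1 (h.obst_abs_le hψ0 hx₁')).2
  have hψ₂ : ψ x₁ ≤ K / 4 := by
    have : e * ‖x₁‖ ≤ K * (1 / 4) := by gcongr
    linarith
  have hball : ∀ x, ‖x - x₁‖ ≤ 1 / 4 → ‖x‖ ≤ 1 / 2 := fun x hx => by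
    have := norm_add_le (x - x₁) x₁
    rw [sub_add_cancel] at this
    linarith
  have hℓ : ∀ x, ‖x - x₁‖ ≤ 1 / 4 → ℓ x₁ x - ℓ x₁ x₁ ≤ K / 4 := fun x hx => by
    rw [← map_sub]
    have h1 := (le_abs_self _).trans ((ℓ x₁).le_opNorm (x - x₁))
    have h2 : ‖ℓ x₁‖ * ‖x - x₁‖ ≤ K * (1 / 4) := by
      gcongr
      exact (h.obst_grad x₁ hx₁').trans heK
    linarith
  have key := quadBarrier_le_on_cylinder (v := v) (m := x₁) (ρ := 1 / 4)
    (c := ψ x₁ - ℓ x₁ x₁) (A := -(64 * K)) (B := -(θ / 2)) (ℓ := ℓ x₁) (by linarith) hη0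
    (h.cont.mono fun q hq => ⟨by linarith [hball q.1 hq.1], hq.2.1, by linarith [hq.2.2]⟩)
    (fun q h1 h2 h3 => h.lap q (by linarith [hball q.1 h1.le]) h2 (by linarith))
    ?_ ?_ ?_ (q := (x₁, 0)) (by simp) le_rfl hη0.le
  · simpa [quadBarrier] using key
  · intro q h1 h2 h3
    simp only [quadBarrier, h1]
    have h4 := hlow2 q.1 q.2 (hball _ h1.le) h2 h3
    have h5 := mul_le_mul_of_nonneg_left ((hy2 q.2 h2 h3).2.trans
      (by linarith : η / 8 ≤ 1 / 64)) (by linarith : 0 ≤ 64 * K)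
    have h6 := mul_nonneg hθ.le h2
    refine le_trans ?_ h4
    linarith [hℓ _ h1.le]
  · intro x hx
    simp only [quadBarrier, hdη]
    have h4 := hlow2 x η (hball _ hx) hη0.le le_rfl
    have h5 := mul_le_mul_of_nonneg_left hη8 hK.le
    have h6 := mul_nonneg hK.le (sq_nonneg ‖x - x₁‖)
    linarith [hℓ _ hx]
  · intro x hx hlt
    have hx1 : ‖x‖ < 1 := by linarith [hball x hx.le]
    refine ⟨F x, ?_, h.flux x hx1⟩
    have h1 := (abs_le.1 (h.obst_taylor x₁ x hx₁' hx1)).1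
    rw [map_sub] at h1
    simp only [quadBarrier] at hlt
    have h2 : e * ‖x - x₁‖ ^ 2 ≤ K * ‖x - x₁‖ ^ 2 := by gcongr
    have h3 := mul_nonneg hK.le (sq_nonneg ‖x - x₁‖)
    have := hflux x hx1 (by linarith)
    linarith

/-- If the horizontal slope is small compared to `θ`, then near a contact point `v` stays on one
side of the obstacle. -/
theorem one_sided (h : ThinSol v ψ F ℓ e Λ θ) (hθ : 0 < θ) (hΛ : 0 ≤ Λ)
    (hK : 0 < K) (heK : e ≤ K) (hKθ : 96 * (d + 1) * K ≤ θ) (hΛK : 8 * Λ * K ≤ θ)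
    (hL : LipX K v 1) (hv0 : v (0, 0) = 0) (hψ0 : ψ 0 = 0) :
    (∀ x, ‖x‖ ≤ 1 / 4 → ψ x ≤ v (x, 0)) ∨ (∀ x, ‖x‖ ≤ 1 / 4 → v (x, 0) ≤ ψ x) := by
  rcases le_total 0 (v (0, 1 / (8 * (d + 1)))) with h1 | h1
  · exact .inl fun x hx => h.obst_le_of_nonneg hθ hΛ hK heK hKθ hΛK hL hv0 hψ0 h1 hx
  · right
    intro x hx
    have := h.neg.obst_le_of_nonneg hθ hΛ hK heK hKθ hΛK hL.neg (by simp [hv0])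
      (by simp [hψ0]) (by simpa using h1) hx
    linarith

end ThinSol

/-- The gap between twice the distance to the hyperplane, weighted by the slope `K`, and the odd
part of `v` with respect to the reflection across that hyperplane. -/
noncomputable def slopeDefect {d : ℕ} (K : ℝ) (v : Esp d × ℝ → ℝ) (m ν : Esp d)
    (q : Esp d × ℝ) : ℝ :=
  2 * K * ⟪q.1 - m, ν⟫ - (v q - v (reflAt m ν q.1, q.2))

namespace ThinSol

variable {d : ℕ} {v : Esp d × ℝ → ℝ} {ψ F : Esp d → ℝ} {ℓ : Esp d → Esp d →L[ℝ] ℝ}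
  {e Λ θ K : ℝ} {m ν : Esp d}

theorem norm_lt_of_sub {x : Esp d} (hm : ‖m‖ < 1 / 4) (hx : ‖x - m‖ ≤ 1 / 2) : ‖x‖ < 1 := by
  have := norm_add_le (x - m) m
  rw [sub_add_cancel] at this
  linarith

theorem norm_reflAt_lt_of_sub {x : Esp d} (hν : ‖ν‖ = 1) (hm : ‖m‖ < 1 / 4)
    (hx : ‖x - m‖ ≤ 1 / 2) : ‖reflAt m ν x‖ < 1 :=
  norm_lt_of_sub hm ((norm_reflAt_sub hν x).trans_le hx)

theorem slopeDefect_nonneg (hL : LipX K v 1) (hν : ‖ν‖ = 1) (hm : ‖m‖ < 1 / 4)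
    {q : Esp d × ℝ} (hq : ‖q.1 - m‖ ≤ 1 / 2) (hy : 0 ≤ q.2) (hy1 : q.2 < 1)
    (hs : 0 ≤ ⟪q.1 - m, ν⟫) : 0 ≤ slopeDefect K v m ν q := by
  have := hL q.1 (reflAt m ν q.1) q.2 (norm_lt_of_sub hm hq) (norm_reflAt_lt_of_sub hν hm hq)
    hy hy1
  rw [norm_sub_reflAt hν hs] at this
  unfold slopeDefect
  linarith

theorem continuousOn_slopeDefect (h : ThinSol v ψ F ℓ e Λ θ) (hν : ‖ν‖ = 1) (hm : ‖m‖ < 1 / 4) :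
    ContinuousOn (slopeDefect K v m ν) {q | ‖q.1 - m‖ ≤ 1 / 2 ∧ 0 ≤ q.2 ∧ q.2 < 1} := by
  have h1 : Continuous fun q : Esp d × ℝ => 2 * K * ⟪q.1 - m, ν⟫ := by fun_prop
  refine h1.continuousOn.sub ((h.cont.mono fun q hq => ⟨norm_lt_of_sub hm hq.1, hq.2⟩).sub
    (h.cont.comp (f := fun q : Esp d × ℝ => (reflAt m ν q.1, q.2)) ?_
      fun q hq => ⟨norm_reflAt_lt_of_sub hν hm hq.1, hq.2⟩))
  exact ((continuous_reflAt.comp continuous_fst).prodMk continuous_snd).continuousOn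

theorem hasLaplacian_slopeDefect (h : ThinSol v ψ F ℓ e Λ θ) (hν : ‖ν‖ = 1) (hm : ‖m‖ < 1 / 4)
    {q : Esp d × ℝ} (hq : ‖q.1 - m‖ ≤ 1 / 2) (hy : 0 < q.2) (hy1 : q.2 < 1) :
    HasLaplacian (slopeDefect K v m ν) q 0 := by
  have h1 := ((HasLaplacian.clm (p := q) (innerSL ℝ ν)).const_mul (2 * K)).sub
    (((HasLaplacian.const (2 * K * ⟪m, ν⟫)).add (h.lap q (norm_lt_of_sub hm hq) hy hy1)).sub
    ((h.lap (reflAt m ν q.1, q.2) (norm_reflAt_lt_of_sub hν hm hq) hy hy1).comp_reflAt hν))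
  refine h1.congr (fun q => ?_) (by ring)
  simp only [slopeDefect, innerSL_apply_apply, inner_sub_left]
  rw [real_inner_comm ν q.1]
  ring

theorem normalDeriv_slopeDefect (h : ThinSol v ψ F ℓ e Λ θ) (hν : ‖ν‖ = 1) (hm : ‖m‖ < 1 / 4)
    {x : Esp d} (hx : ‖x - m‖ ≤ 1 / 2) :
    NormalDeriv d (slopeDefect K v m ν) x (F (reflAt m ν x) - F x) := by
  have h1 : NormalDeriv d (fun q => 2 * K * ⟪q.1 - m, ν⟫) x 0 :=
    .of_hasDerivAt (hasDerivAt_const (0 : ℝ) (2 * K * ⟪x - m, ν⟫))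
  have h2 := h1.sub ((h.flux x (norm_lt_of_sub hm hx)).sub
    (w := fun q => v (reflAt m ν q.1, q.2))
    (h.flux (reflAt m ν x) (norm_reflAt_lt_of_sub hν hm hx)))
  rw [zero_sub, neg_sub] at h2
  exact h2

/-- Away from the hyperplane, the two phases have opposite fluxes on the two sides, so the slope
defect is bounded below. -/
theorem le_slopeDefect (h : ThinSol v ψ F ℓ e Λ θ) (hθ : 0 < θ) (hΛ : 0 ≤ Λ)
    (hKθ : θ ≤ 96 * (d + 1) * K) (he : 0 ≤ e) (heK : 16 * e ≤ K) (hΛK : 4 * Λ * K < θ)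
    (hL : LipX K v 1) (hv0 : v (0, 0) = 0) (hψ0 : ψ 0 = 0)
    (hν : ‖ν‖ = 1) (hm : ‖m‖ ≤ 1 / 100) {q : Esp d × ℝ}
    (hq : ‖q.1 - (m + (1 / 4 : ℝ) • ν)‖ ≤ 1 / 128) (hy : 0 ≤ q.2)
    (hyη : q.2 ≤ 1 / (768 * (d + 1)) / 4) :
    3 / 16 * θ * (1 / (768 * (d + 1))) ≤ slopeDefect K v m ν q := by
  have hd : (0 : ℝ) ≤ d := Nat.cast_nonneg d
  set η : ℝ := 1 / (768 * (d + 1)) with hη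
  have hη0 : 0 < η := by positivity
  have hηd : (d + 1) * η = 1 / 768 := by rw [hη]; field_simp
  have hη8 : η ≤ 1 / 768 := by nlinarith
  have hdη : (d + 1) * η ^ 2 = η / 768 := by rw [pow_two, ← mul_assoc, hηd]; ring
  have hKη : θ * η ≤ K / 8 := by
    have := mul_le_mul_of_nonneg_left hKθ hη0.le
    have h2 : η * (96 * (d + 1) * K) = K / 8 := by
      rw [show η * (96 * (d + 1) * K) = 96 * ((d + 1) * η) * K by ring, hηd]; ring
    linarith
  have hK : 0 < K := by nlinarith [mul_pos hθ hη0]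
  have hy2 : ∀ y : ℝ, 0 ≤ y → y ≤ η → 0 ≤ (d + 1) * y ^ 2 ∧ (d + 1) * y ^ 2 ≤ η / 768 :=
    fun y h1 h2 => ⟨by positivity, by rw [← hdη]; gcongr⟩
  have hm4 : ‖m‖ < 1 / 4 := by linarith
  set p₀ := m + (1 / 4 : ℝ) • ν with hp₀
  have hdist : ∀ x, ‖x - m‖ ≤ ‖x - p₀‖ + 1 / 4 := fun x => by
    have h1 : x - m = (x - p₀) + (1 / 4 : ℝ) • ν := by rw [hp₀]; abel
    rw [h1]
    refine (norm_add_le _ _).trans ?_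
    rw [norm_smul, hν]
    norm_num
  have hinner : ∀ x, 1 / 4 - ‖x - p₀‖ ≤ ⟪x - m, ν⟫ := fun x => by
    have h1 : x - m = (x - p₀) + (1 / 4 : ℝ) • ν := by rw [hp₀]; abel
    rw [h1, inner_add_left, real_inner_smul_left, real_inner_self_eq_norm_sq, hν]
    have h2 := (abs_le.1 (abs_real_inner_le_norm (x - p₀) ν)).1
    rw [hν] at h2
    linarith
  set c₀ := θ * η / 2 with hc₀
  have hc₀0 : 0 < c₀ := by positivity
  have key := quadBarrier_le_on_cylinder (v := slopeDefect K v m ν) (m := p₀) (ρ := 1 / 32)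
    (c := c₀) (A := -(2048 * c₀)) (B := -θ) (ℓ := 0) (η := η) (by linarith) hη0
    ((h.continuousOn_slopeDefect hν hm4).mono fun q hq =>
      ⟨by linarith [hdist q.1, hq.1], hq.2.1, by linarith [hq.2.2]⟩)
    (fun q h1 h2 h3 => h.hasLaplacian_slopeDefect hν hm4 (by linarith [hdist q.1]) h2
      (by linarith))
    ?_ ?_ ?_ (q := q) (by linarith) hy (by linarith)
  · refine le_trans ?_ key
    simp only [quadBarrier, zero_apply]
    have h1 := (hy2 q.2 hy (by linarith)).1
    have h2 : ‖q.1 - p₀‖ ^ 2 ≤ (1 / 128) ^ 2 := by gcongr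
    have h3 := mul_le_mul_of_nonneg_left h2 (by linarith : 0 ≤ 2048 * c₀)
    have h4 := mul_le_mul_of_nonneg_left hyη hθ.le
    have h5 := mul_nonneg (by linarith : 0 ≤ 2048 * c₀) h1
    linarith
  · intro q h1 h2 h3
    refine le_trans ?_ (slopeDefect_nonneg hL hν hm4 (by linarith [hdist q.1]) h2 (by linarith)
      (by linarith [hinner q.1]))
    simp only [quadBarrier, zero_apply, h1]
    have h5 := mul_le_mul_of_nonneg_left ((hy2 q.2 h2 h3).2.trans
      (by linarith : η / 768 ≤ 1 / 589824)) (by linarith : 0 ≤ 2048 * c₀)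
    have h6 := mul_nonneg hθ.le h2
    linarith
  · intro x hx
    refine le_trans ?_ (slopeDefect_nonneg hL hν hm4 (q := (x, η)) (by linarith [hdist x])
      hη0.le (by simp only; linarith) (by linarith [hinner x]))
    simp only [quadBarrier, zero_apply, hdη]
    have h5 := mul_le_mul_of_nonneg_left (by linarith : η / 768 ≤ 1 / 589824)
      (by linarith : 0 ≤ 2048 * c₀)
    have h6 := mul_nonneg (by linarith : 0 ≤ 2048 * c₀) (sq_nonneg ‖x - p₀‖)
    linarith
  · intro x hx hlt
    have hxm : ‖x - m‖ ≤ 9 / 32 := by linarith [hdist x]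
    have hx1 := norm_lt_of_sub hm4 (by linarith : ‖x - m‖ ≤ 1 / 2)
    have hσ1 := norm_reflAt_lt_of_sub hν hm4 (by linarith : ‖x - m‖ ≤ 1 / 2)
    have hb : ∀ z, ‖z‖ < 1 → |v (z, 0)| ≤ K * ‖z‖ ∧ |ψ z| ≤ K / 16 := fun z hz =>
      ⟨bottom_abs_le hL hv0 hz, (h.obst_abs_le hψ0 hz).trans (by nlinarith [norm_nonneg z])⟩
    have hz : ∀ z : Esp d, ‖z - m‖ ≤ 9 / 32 → K * ‖z‖ ≤ K * (9 / 32 + 1 / 100) := fun z hz => by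
      gcongr
      have := norm_add_le (z - m) m
      rw [sub_add_cancel] at this
      linarith
    have hzx := hz x hxm
    have hzσ := hz _ ((norm_reflAt_sub hν x).trans_le hxm)
    obtain ⟨hvx, hψx⟩ := hb x hx1
    obtain ⟨hvσ, hψσ⟩ := hb _ hσ1
    rw [abs_le] at hvx hψx hvσ hψσ
    have hs := mul_le_mul_of_nonneg_left (hinner x) hK.le
    have hs' := mul_lt_mul_of_pos_left hx hK
    simp only [quadBarrier, zero_apply, slopeDefect] at hlt
    have h5 := mul_nonneg hc₀0.le (sq_nonneg ‖x - p₀‖)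
    have hpos : ψ x < v (x, 0) := by
      by_contra! hcon
      linarith
    have hneg : v (reflAt m ν x, 0) < ψ (reflAt m ν x) := by
      by_contra! hcon
      linarith
    refine ⟨_, ?_, h.normalDeriv_slopeDefect hν hm4 (by linarith)⟩
    have h6 := h.flux_pos x hx1 hpos
    have h7 := h.flux_neg _ hσ1 hneg
    have h8 : Λ * (v (x, 0) - ψ x) ≤ Λ * K := by gcongr; linarith
    have h9 : Λ * (ψ (reflAt m ν x) - v (reflAt m ν x, 0)) ≤ Λ * K := by gcongr; linarith
    linarith

/-- The rate at which the horizontal slope decays between consecutive scales. -/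
noncomputable def _root_.decayRate (d : ℕ) : ℝ :=
  4 / 3 * (1 / (768 * (d + 1))) *
    Real.exp (-((d + 1) / (1 / (6144 * (d + 1))) ^ 2) * (1 / 4) ^ 2)

theorem _root_.decayRate_pos (d : ℕ) : 0 < decayRate d := by
  unfold decayRate
  positivity

theorem _root_.decayRate_lt_one (d : ℕ) : decayRate d < 1 := by
  unfold decayRate
  have hd : (0 : ℝ) ≤ d := Nat.cast_nonneg d
  have h1 : Real.exp (-((d + 1) / (1 / (6144 * (d + 1))) ^ 2) * (1 / 4) ^ 2) ≤ 1 := by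
    rw [Real.exp_le_one_iff]
    have : (0 : ℝ) ≤ (d + 1) / (1 / (6144 * (d + 1))) ^ 2 := by positivity
    linarith
  have h2 : 1 / (768 * ((d : ℝ) + 1)) ≤ 1 / 768 := by
    gcongr
    linarith
  have h3 : 0 < 1 / (768 * ((d : ℝ) + 1)) := by positivity
  nlinarith [Real.exp_pos (-(((d : ℝ) + 1) / (1 / (6144 * (d + 1))) ^ 2) * (1 / 4) ^ 2)]

end ThinSol

theorem exp_neg_sub_le {a b : ℝ} (ha : 0 ≤ a) (hab : a ≤ b) :
    Real.exp (-a) - Real.exp (-b) ≤ b - a := by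
  have h1 := Real.add_one_le_exp (a - b)
  have h2 : Real.exp (-b) = Real.exp (-a) * Real.exp (a - b) := by
    rw [← Real.exp_add]; congr 1; ring
  have h3 : Real.exp (-a) ≤ 1 := Real.exp_le_one_iff.2 (by linarith)
  have h4 := Real.exp_pos (-a)
  rw [h2]
  nlinarith

theorem mul_exp_neg_le_sub (a b : ℝ) :
    (b - a) * Real.exp (-b) ≤ Real.exp (-a) - Real.exp (-b) := by
  have h1 := Real.add_one_le_exp (b - a)
  have h2 : Real.exp (-a) = Real.exp (-b) * Real.exp (b - a) := by
    rw [← Real.exp_add]; congr 1; ring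
  have h4 := Real.exp_pos (-b)
  rw [h2]
  nlinarith

namespace ThinSol

variable {d : ℕ} {v : Esp d × ℝ → ℝ} {ψ F : Esp d → ℝ} {ℓ : Esp d → Esp d →L[ℝ] ℝ}
  {e Λ θ K : ℝ} {m ν : Esp d}

set_option maxHeartbeats 1000000 in
/-- Quantitative Hopf lemma for the slope defect. -/
theorem hopf_slopeDefect (h : ThinSol v ψ F ℓ e Λ θ) (hθ : 0 < θ) (hΛ : 0 ≤ Λ)
    (hKθ : θ ≤ 96 * (d + 1) * K) (he : 0 ≤ e) (heK : 16 * e ≤ K)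
    (hΛK : 4 * Λ * K < decayRate d * θ)
    (hL : LipX K v 1) (hv0 : v (0, 0) = 0) (hψ0 : ψ 0 = 0)
    (hν : ‖ν‖ = 1) (hm : ‖m‖ ≤ 1 / (6144 * (d + 1))) {yt t : ℝ} (hyt : 0 ≤ yt)
    (hytr : yt ≤ 1 / (6144 * (d + 1))) (ht : 0 ≤ t) (htr : t ≤ 1 / (6144 * (d + 1))) :
    2 * decayRate d * θ * t ≤ slopeDefect K v m ν (m + t • ν, yt) := by
  have hd : (0 : ℝ) ≤ d := Nat.cast_nonneg d
  have hκ1 := decayRate_lt_one d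
  have hκ0 := decayRate_pos d
  set r : ℝ := 1 / (6144 * (d + 1)) with hr
  have hr0 : 0 < r := by positivity
  have hrd : (d + 1) * r = 1 / 6144 := by rw [hr]; field_simp
  have hr1 : r ≤ 1 / 6144 := by nlinarith
  have hη : 1 / (768 * ((d : ℝ) + 1)) = 8 * r := by rw [hr]; field_simp; norm_num
  set α : ℝ := (d + 1) / r ^ 2 with hα
  have hα0 : 0 < α := by positivity
  have hαr : α * r ^ 2 = d + 1 := by rw [hα]; field_simp
  have hα1 : 1 ≤ α := by
    have : α * r ^ 2 ≤ α * 1 := by gcongr; nlinarith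
    linarith
  set E₀ : ℝ := Real.exp (-α * (1 / 4) ^ 2) with hE₀
  have hE₀0 : 0 < E₀ := Real.exp_pos _
  set κ := decayRate d with hκ
  have hκE : κ = 4 / 3 * (8 * r) * E₀ := by rw [hκ, decayRate, hη, ← hr, ← hα]
  set c : ℝ := 128 * r * θ / α with hc
  have hcα : c * α = 128 * r * θ := by rw [hc]; field_simp
  have hc0 : 0 < c := by positivity
  have hcr : c ≤ 3 / 16 * θ * (8 * r) := by
    rw [hc, div_le_iff₀ hα0]
    have h1 : 128 * 6144 ≤ α := by
      have h2 : α * r ^ 2 ≤ α * (r * (1 / 6144)) := by rw [pow_two]; gcongr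
      have h3 : 1 * 6144 * (d + 1) ≤ α := by
        have h4 : (d + 1) * 6144 * ((d + 1) * r) ≤ α * ((d + 1) * r) := by
          rw [hrd]
          have h5 : α * r ^ 2 * (d + 1) ≤ α * (r * (1 / 6144)) * (d + 1) := by gcongr
          rw [hαr] at h5
          have h6 : α * (r * (1 / 6144)) * (d + 1) = α * (1 / 6144) * (1 / 6144) := by
            rw [← hrd]; ring
          rw [h6] at h5
          nlinarith
        have := le_of_mul_le_mul_right h4 (by rw [hrd]; norm_num)
        linarith
      have h5 : α * ((d + 1) * r) * ((d + 1) * r) = (d + 1) ^ 3 := by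
        rw [← mul_one ((d + 1 : ℝ) ^ 3), show ((d : ℝ) + 1) ^ 3 = (d + 1) * (d + 1) ^ 2 by ring,
          ← hαr]
        ring
      rw [hrd] at h5
      have h6 : (1 : ℝ) ≤ (d + 1) ^ 3 := one_le_pow₀ (by linarith)
      linarith
    have h2 : 3 / 16 * θ * (8 * r) * (128 * 6144) ≤ 3 / 16 * θ * (8 * r) * α := by gcongr
    have h3 := mul_pos hθ hr0
    linarith
  have hKη : θ * (8 * r) ≤ K / 8 := by
    have := mul_le_mul_of_nonneg_left hKθ hr0.le
    have h2 : r * (96 * (d + 1) * K) = K / 64 := by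
      rw [show r * (96 * (d + 1) * K) = 96 * ((d + 1) * r) * K by ring, hrd]; ring
    linarith
  have hK : 0 < K := by nlinarith [mul_pos hθ hr0]
  have hm4 : ‖m‖ < 1 / 4 := by linarith
  set p₀ := m + (1 / 4 : ℝ) • ν with hp₀
  have hxp : ∀ x, x - m = (x - p₀) + (1 / 4 : ℝ) • ν := fun x => by rw [hp₀]; abel
  have hdist : ∀ x, ‖x - m‖ ≤ ‖x - p₀‖ + 1 / 4 := fun x => by
    rw [hxp]
    refine (norm_add_le _ _).trans ?_
    rw [norm_smul, hν]
    norm_num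
  have hinner : ∀ x, |⟪x - m, ν⟫ - 1 / 4| ≤ ‖x - p₀‖ := fun x => by
    rw [hxp, inner_add_left, real_inner_smul_left, real_inner_self_eq_norm_sq, hν]
    have h2 := abs_real_inner_le_norm (x - p₀) ν
    rw [hν] at h2
    simpa using h2
  have hsq1 : ∀ q : Esp d × ℝ, ∀ R, 0 ≤ R → sqDist p₀ yt q ≤ R ^ 2 →
      ‖q.1 - p₀‖ ≤ R ∧ |q.2 - yt| ≤ R := fun q R hR hq => by
    unfold sqDist at hq
    exact ⟨(abs_le_of_sq_le_sq' (by nlinarith [sq_nonneg (q.2 - yt)]) hR).2,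
      abs_le_of_sq_le_sq (by nlinarith [sq_nonneg ‖q.1 - p₀‖]) hR⟩
  set S : Esp d × ℝ → ℝ := fun q => ⟪q.1 - m, ν⟫ with hS
  have hdom : ∀ q : Esp d × ℝ, sqDist p₀ yt q ≤ (1 / 4) ^ 2 →
      ‖q.1 - m‖ ≤ 1 / 2 ∧ q.2 < 1 ∧ 0 ≤ S q := fun q hq => by
    obtain ⟨h1, h2⟩ := hsq1 q (1 / 4) (by norm_num) hq
    have h3 := (abs_le.1 h2).2
    have h4 := (abs_le.1 (hinner q.1)).1
    refine ⟨by linarith [hdist q.1], by linarith, ?_⟩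
    simp only [hS]
    linarith
  set g : Esp d × ℝ → ℝ := fun q => Real.exp (-α * (‖q.1 - p₀‖ ^ 2 + (q.2 - yt) ^ 2)) with hg
  set G : Esp d × ℝ → ℝ := fun q => slopeDefect K v m ν q + κ * θ * (S q - S q * q.2)
    - (c * g q - c * E₀) with hG
  set E : Set (Esp d × ℝ) :=
    {q | r ^ 2 ≤ sqDist p₀ yt q ∧ sqDist p₀ yt q ≤ (1 / 4) ^ 2 ∧ 0 ≤ q.2} with hE
  have hsd := continuous_sqDist p₀ yt
  have hEcl : IsClosed E :=
    (isClosed_le continuous_const hsd).inter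
      ((isClosed_le hsd continuous_const).inter (isClosed_le continuous_const continuous_snd))
  have hEc : IsCompact E :=
    isCompact_of_sqDist_le (by norm_num : (0 : ℝ) ≤ 1 / 4) hEcl fun q hq => hq.2.1
  have hSc : Continuous S := by simp only [hS]; fun_prop
  have hgc : Continuous g := by simp only [hg]; fun_prop
  have hGc : ContinuousOn G E :=
    (((h.continuousOn_slopeDefect hν hm4).mono fun q hq =>
      ⟨(hdom q hq.2.1).1, hq.2.2, (hdom q hq.2.1).2.1⟩).add
      (by fun_prop : Continuous fun q => κ * θ * (S q - S q * q.2)).continuousOn).sub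
      (by fun_prop : Continuous fun q => c * g q - c * E₀).continuousOn
  have hSy : ∀ q ∈ E, 0 ≤ κ * θ * (S q - S q * q.2) := fun q hq => by
    obtain ⟨-, h2, h3⟩ := hdom q hq.2.1
    have : 0 ≤ S q * (1 - q.2) := mul_nonneg h3 (by linarith)
    have h4 : 0 ≤ κ * θ := by positivity
    have := mul_nonneg h4 this
    linarith
  have hmain : ∀ q ∈ E, 0 ≤ G q := by
    refine nonneg_of_min_principle hEc hGc ?_
    rintro ⟨x, y⟩ hp hneg
    obtain ⟨hp1, hp2, hp3⟩ := hp
    have hp3 : 0 ≤ y := hp3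
    obtain ⟨hx, hy1, hs⟩ := hdom _ hp2
    have hV := slopeDefect_nonneg (q := (x, y)) hL hν hm4 hx hp3 hy1 hs
    have hSy0 := hSy (x, y) ⟨hp1, hp2, hp3⟩
    have hgsq : ∀ q, g q = Real.exp (-(α * sqDist p₀ yt q)) := fun q => by
      simp only [hg, sqDist, neg_mul]
    have hE₀' : E₀ = Real.exp (-(α * (1 / 4) ^ 2)) := by rw [hE₀, neg_mul]
    have hlt2 : sqDist p₀ yt (x, y) < (1 / 4) ^ 2 := by
      refine lt_of_le_of_ne hp2 fun heq => ?_
      have : g (x, y) = E₀ := by rw [hgsq, hE₀', heq]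
      simp only [hG, this] at hneg
      linarith
    have hlt1 : r ^ 2 < sqDist p₀ yt (x, y) := by
      refine lt_of_le_of_ne hp1 fun heq => ?_
      obtain ⟨h1, h2⟩ := hsq1 (x, y) r hr0.le heq.symm.le
      have h3 := (abs_le.1 h2).2
      have h4 := h.le_slopeDefect hθ hΛ hKθ he heK
        (hΛK.trans (by nlinarith)) hL hv0 hψ0 hν (m := m) (by linarith) (q := (x, y))
        (by simp only at h1 ⊢; linarith) hp3 (by rw [hη]; simp only at h3 ⊢; linarith)
      rw [hη] at h4
      have h5 : g (x, y) ≤ 1 := by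
        rw [hgsq, Real.exp_le_one_iff, ← heq]
        have : 0 < α * r ^ 2 := by positivity
        linarith
      have h6 : c * g (x, y) ≤ c * 1 := by gcongr
      have h7 : 0 < c * E₀ := by positivity
      simp only [hG] at hneg
      linarith
    have hnhds : ∀ᶠ q in 𝓝 (x, y), r ^ 2 ≤ sqDist p₀ yt q ∧ sqDist p₀ yt q ≤ (1 / 4) ^ 2 := by
      filter_upwards [hsd.continuousAt.eventually_const_lt hlt1,
        hsd.continuousAt.eventually_lt_const hlt2] with q h1 h2 using ⟨h1.le, h2.le⟩
    rcases hp3.eq_or_lt with rfl | hy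
    · right
      refine ⟨rfl, ?_, ?_⟩
      · have hcont : Filter.Tendsto (fun t : ℝ => ((x, t) : Esp d × ℝ)) (𝓝[>] 0) (𝓝 (x, 0)) :=
          ((by fun_prop : Continuous fun t : ℝ => ((x, t) : Esp d × ℝ)).tendsto 0).mono_left
            nhdsWithin_le_nhds
        filter_upwards [hcont.eventually hnhds, self_mem_nhdsWithin] with t h1 h2
        exact ⟨h1.1, h1.2, le_of_lt h2⟩
      have hnx : ‖x - p₀‖ < 1 / 4 := by
        refine (abs_lt_of_sq_lt_sq' ?_ (by norm_num)).2
        unfold sqDist at hlt2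
        simp only at hlt2
        nlinarith [sq_nonneg (0 - yt)]
      have hs' : 0 < ⟪x - m, ν⟫ := by linarith [(abs_le.1 (hinner x)).1]
      have hder : NormalDeriv d g x (g (x, 0) * (2 * α * yt)) := by
        refine .of_hasDerivAt ?_
        have h2 := (((((hasDerivAt_id (0 : ℝ)).sub_const yt).pow 2).const_add
          (‖x - p₀‖ ^ 2)).const_mul (-α)).exp
        convert! h2 using 1
        simp [hg]
        ring
      have hder2 : NormalDeriv d (fun q => κ * θ * (S q - S q * q.2)) x
          (κ * θ * (-⟪x - m, ν⟫)) := by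
        refine .of_hasDerivAt ?_
        have h2 := (((hasDerivAt_id (0 : ℝ)).const_mul ⟪x - m, ν⟫).const_sub
          ⟪x - m, ν⟫).const_mul (κ * θ)
        convert! h2 using 1
        simp
      have hder3 : NormalDeriv d (fun _ => c * E₀) x 0 :=
        .of_hasDerivAt (hasDerivAt_const (0 : ℝ) (c * E₀))
      refine ⟨_, ?_, ((h.normalDeriv_slopeDefect hν hm4 hx).add hder2).sub
        ((hder.const_mul c).sub hder3)⟩
      have hg0 : 0 ≤ c * (g (x, 0) * (2 * α * yt)) := by
        have : 0 < g (x, 0) := Real.exp_pos _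
        positivity
      have hx1 := norm_lt_of_sub hm4 hx
      have hσ1 := norm_reflAt_lt_of_sub hν hm4 hx
      have hψ := h.obst_lip x _ hx1 hσ1
      rw [norm_sub_reflAt hν hs'.le, abs_le] at hψ
      have hvL := hL x (reflAt m ν x) 0 hx1 hσ1 le_rfl one_pos
      rw [norm_sub_reflAt hν hs'.le] at hvL
      have heK' : e * ⟪x - m, ν⟫ ≤ K / 16 * ⟪x - m, ν⟫ := by gcongr; linarith
      by_cases hw : v (reflAt m ν x, 0) - ψ (reflAt m ν x) < v (x, 0) - ψ x
      · have h1 := h.flux_mono x _ hx1 hσ1 hw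
        have h2 : Λ * ((v (x, 0) - ψ x) - (v (reflAt m ν x, 0) - ψ (reflAt m ν x)))
            ≤ Λ * (4 * K * ⟪x - m, ν⟫) := by
          have := mul_pos hK hs'
          gcongr
          linarith
        have h3 := mul_lt_mul_of_pos_right hΛK hs'
        linarith
      · exfalso
        push Not at hw
        have h1 : g (x, 0) - E₀ ≤ α * (1 / 4) ^ 2 - α * sqDist p₀ yt (x, 0) := by
          rw [hgsq, hE₀']
          refine exp_neg_sub_le ?_ ?_
          · have : 0 ≤ sqDist p₀ yt (x, 0) := by unfold sqDist; positivity
            positivity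
          · gcongr
        have h2 : (1 / 4) ^ 2 - sqDist p₀ yt (x, 0) ≤ ⟪x - m, ν⟫ / 2 := by
          have h3 : (⟪x - m, ν⟫ - 1 / 4) ^ 2 ≤ ‖x - p₀‖ ^ 2 := by
            rw [← sq_abs]
            gcongr
            exact hinner x
          unfold sqDist
          simp only
          nlinarith [sq_nonneg (0 - yt), sq_nonneg ⟪x - m, ν⟫]
        have h3 := mul_le_mul_of_nonneg_left h1 hc0.le
        have h4 := mul_le_mul_of_nonneg_left h2 (by positivity : 0 ≤ c * α)
        have h5 : c * α * (⟪x - m, ν⟫ / 2) ≤ K * ⟪x - m, ν⟫ := by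
          rw [hcα]
          have := mul_le_mul_of_nonneg_right hKη hs'.le
          linarith
        simp only [hG, slopeDefect] at hneg
        linarith
    · left
      constructor
      · filter_upwards [hnhds, continuous_snd.continuousAt.eventually_const_lt hy] with q h1 h2
        exact ⟨h1.1, h1.2, h2.le⟩
      have hlapS : HasLaplacian (fun q => κ * θ * (S q - S q * q.2)) (x, y) 0 := by
        have h1 := (((HasLaplacian.clm (p := (x, y)) (innerSL ℝ ν)).sub
          (HasLaplacian.const ⟪m, ν⟫)).sub (HasLaplacian.inner_mul_snd m ν)).const_mul (κ * θ)
        refine h1.congr (fun q => ?_) (by ring)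
        simp only [hS, innerSL_apply_apply, inner_sub_left]
        rw [real_inner_comm ν q.1]
      have hlapg := HasLaplacian.gaussian (p := (x, y)) α p₀ yt
      refine ⟨_, ?_, ((h.hasLaplacian_slopeDefect hν hm4 hx hy hy1).add hlapS).sub
        ((hlapg.const_mul c).sub (HasLaplacian.const (c * E₀)))⟩
      have h1 : 0 < 4 * α ^ 2 * (‖x - p₀‖ ^ 2 + (y - yt) ^ 2) - 2 * α * (d + 1) := by
        have h2 : α ^ 2 * r ^ 2 ≤ α ^ 2 * (‖x - p₀‖ ^ 2 + (y - yt) ^ 2) := by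
          gcongr
          exact hp1
        have h3 : α ^ 2 * r ^ 2 = α * (d + 1) := by rw [← hαr]; ring
        have h4 : 0 < α * (d + 1) := by positivity
        linarith
      have h2 := Real.exp_pos (-α * (‖x - p₀‖ ^ 2 + (y - yt) ^ 2))
      have := mul_pos hc0 (mul_pos h1 h2)
      simp only
      linarith
  have hnp : ‖m + t • ν - p₀‖ = 1 / 4 - t := by
    rw [show m + t • ν - p₀ = (-(1 / 4 - t)) • ν by rw [hp₀]; module, norm_smul, hν, norm_neg,
      Real.norm_eq_abs, abs_of_nonneg (by linarith), mul_one]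
  have hsdq : sqDist p₀ yt (m + t • ν, yt) = (1 / 4 - t) ^ 2 := by
    simp only [sqDist, hnp, sub_self]
    ring
  have hfin := hmain (m + t • ν, yt) ⟨by rw [hsdq]; gcongr; linarith,
    by rw [hsdq]; exact pow_le_pow_left₀ (by linarith) (by linarith) 2, hyt⟩
  have hSt : S (m + t • ν, yt) = t := by
    simp only [hS, add_sub_cancel_left, real_inner_smul_left, real_inner_self_eq_norm_sq, hν]
    ring
  simp only [hG, hSt] at hfin
  have hgt : α * (t / 4) * E₀ ≤ g (m + t • ν, yt) - E₀ := by
    have h1 := mul_exp_neg_le_sub (α * (1 / 4 - t) ^ 2) (α * (1 / 4) ^ 2)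
    simp only [hg, hnp, sub_self, hE₀, neg_mul]
    have h2 : α * (t / 4) ≤ α * (1 / 4) ^ 2 - α * (1 / 4 - t) ^ 2 := by
      have h3 : 0 ≤ t * (1 / 4 - t) := mul_nonneg ht (by linarith)
      have := mul_nonneg hα0.le h3
      linarith
    refine (mul_le_mul_of_nonneg_right h2 (Real.exp_pos _).le).trans (h1.trans_eq ?_)
    congr 2
    ring
  have h1 := mul_le_mul_of_nonneg_left hgt hc0.le
  have h2 : c * (α * (t / 4) * E₀) = 3 * (κ * θ * t) := by
    rw [show c * (α * (t / 4) * E₀) = (c * α) * (t / 4) * E₀ by ring, hcα, hκE]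
    ring
  have h3 : 0 ≤ κ * θ * (t * yt) := by positivity
  linarith

/-- The horizontal slope decreases by a definite amount at a smaller scale. -/
theorem lipX_decay (h : ThinSol v ψ F ℓ e Λ θ) (hθ : 0 < θ) (hΛ : 0 ≤ Λ)
    (hKθ : θ ≤ 96 * (d + 1) * K) (he : 0 ≤ e) (heK : 16 * e ≤ K)
    (hΛK : 4 * Λ * K < decayRate d * θ)
    (hL : LipX K v 1) (hv0 : v (0, 0) = 0) (hψ0 : ψ 0 = 0) :
    LipX (K - decayRate d * θ) v (1 / (6144 * (d + 1))) := by
  intro x x' y hx hx' hy hyr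
  rcases eq_or_ne x x' with rfl | hne
  · simp
  obtain ⟨ν, hν, hxν, hxν'⟩ := exists_midpoint_direction hne
  have hn := norm_sub_le x x'
  have hm : ‖(1 / 2 : ℝ) • (x + x')‖ ≤ 1 / (6144 * (d + 1)) := by
    rw [norm_smul, Real.norm_eq_abs, abs_of_pos (by norm_num : (0 : ℝ) < 1 / 2)]
    linarith [norm_add_le x x']
  have key := h.hopf_slopeDefect hθ hΛ hKθ he heK hΛK hL hv0 hψ0 hν hm hy hyr.le
    (t := ‖x - x'‖ / 2) (by positivity) (by linarith)
  simp only [slopeDefect, reflAt_add_smul hν] at key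
  rw [← hxν, ← hxν'] at key
  have h1 : ⟪x - (1 / 2 : ℝ) • (x + x'), ν⟫ = ‖x - x'‖ / 2 := by
    nth_rewrite 1 [hxν]
    rw [add_sub_cancel_left, real_inner_smul_left, real_inner_self_eq_norm_sq, hν]
    ring
  rw [h1] at key
  linarith

end ThinSol

/-- A constant such that a harmonic function with bounded flux that is large at a point is
comparably large at a point whose height is at least this multiple of the distance to the
boundary. -/
noncomputable def liftRate (d : ℕ) : ℝ := 1 / (32 * (d + 1) * 2 ^ (d + 1))

theorem liftRate_pos (d : ℕ) : 0 < liftRate d := by unfold liftRate; positivity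

theorem liftRate_le (d : ℕ) : liftRate d ≤ 1 / 32 := by
  unfold liftRate
  gcongr
  have h1 : (1 : ℝ) ≤ 2 ^ (d + 1) := one_le_pow₀ (by norm_num)
  have h2 : (0 : ℝ) ≤ d := d.cast_nonneg
  nlinarith

theorem liftRate_mul_sq_le (d : ℕ) :
    2 ^ (d + 1) * (d + 1) * (64 * liftRate d ^ 2) ≤ 1 / 8 := by
  have h := liftRate_pos d
  have h1 : 2 ^ (d + 1) * (d + 1) * liftRate d = 1 / 32 := by unfold liftRate; field_simp
  have := liftRate_le d
  calc 2 ^ (d + 1) * (d + 1) * (64 * liftRate d ^ 2)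
      = 64 * (2 ^ (d + 1) * (d + 1) * liftRate d) * liftRate d := by ring
    _ ≤ 1 / 8 := by rw [h1]; linarith

theorem exists_high_point {d : ℕ} {u : Esp d × ℝ → ℝ} {x₀ : Esp d} {y₀ δ M θ : ℝ}
    (hy₀ : 0 ≤ y₀) (hδ : 0 < δ) (hδ1 : δ ≤ 1) (hθ : 0 < θ) (hM : 16 * θ ≤ M)
    (hc : ContinuousOn u {q | ‖q.1 - x₀‖ ≤ δ / 2 ∧ 0 ≤ q.2 ∧ q.2 ≤ y₀ + δ / 2})
    (hlap : ∀ q : Esp d × ℝ, ‖q.1 - x₀‖ ≤ δ / 2 → 0 < q.2 → q.2 ≤ y₀ + δ / 2 →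
      HasLaplacian u q 0)
    (hF : ∀ x, ‖x - x₀‖ ≤ δ / 2 → ∃ D, NormalDeriv d u x D ∧ |D| ≤ θ)
    (hu : ∀ q : Esp d × ℝ, ‖q.1 - x₀‖ ≤ δ / 2 → 0 ≤ q.2 → q.2 ≤ y₀ + δ / 2 →
      |u q| ≤ 2 ^ (d + 1) * M)
    (h₀ : u (x₀, y₀) = M) :
    ∃ x₁ y₁, ‖x₁ - x₀‖ ≤ δ / 4 ∧ liftRate d * δ ≤ y₁ ∧ y₁ ≤ y₀ + δ / 4 ∧
      M / 2 ≤ u (x₁, y₁) := by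
  have hε := liftRate_pos d
  have hε32 := liftRate_le d
  set ε := liftRate d with hεdef
  set N : ℝ := 2 ^ (d + 1) with hN
  have hNpos : 0 < N := by positivity
  rcases le_or_gt (ε * δ) y₀ with hcase | hcase
  · exact ⟨x₀, y₀, by simp; linarith, hcase, by linarith, by rw [h₀]; linarith⟩
  have hεδ : ε * δ ≤ δ / 32 := by nlinarith
  have hεδ0 : 0 < ε * δ := by positivity
  by_contra! hcon
  have hlow : ∀ x : Esp d, ‖x - x₀‖ ≤ δ / 4 → u (x, 2 * (ε * δ)) < M / 2 := fun x hx =>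
    hcon x _ hx (by linarith) (by linarith)
  have hMpos : 0 < M := by linarith
  have hAd : 0 ≤ N * M / (δ / 4) ^ 2 * (d + 1) := by positivity
  have hsq : ∀ y : ℝ, 0 ≤ y → y ≤ 2 * (ε * δ) →
      N * M / (δ / 4) ^ 2 * (d + 1) * y ^ 2 ≤ N * M / (δ / 4) ^ 2 * (d + 1) * (2 * (ε * δ)) ^ 2 :=
    fun y h1 h2 => mul_le_mul_of_nonneg_left (pow_le_pow_left₀ h1 h2 2) hAd
  have hNM : 0 < N * M / (δ / 4) ^ 2 := by positivity
  have key := quadBarrier_le_on_cylinder (v := fun q => -1 * u q) (m := x₀) (ρ := δ / 4)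
    (η := 2 * (ε * δ)) (A := -(N * M / (δ / 4) ^ 2)) (B := 2 * θ) (ℓ := 0)
    (c := -(M / 2 + N * M / (δ / 4) ^ 2 * (d + 1) * (2 * (ε * δ)) ^ 2 + 2 * θ * (2 * (ε * δ))))
    (by linarith) (by linarith)
    (continuousOn_const.mul (hc.mono fun q hq => ⟨by linarith [hq.1], hq.2.1, by linarith [hq.2.2]⟩))
    (fun q h1 h2 h3 => by
      simpa using (hlap q (by linarith) h2 (by linarith)).const_mul (-1))
    (fun q h1 h2 h3 => by
      have hb := (abs_le.1 (hu q (by linarith) h2 (by linarith))).2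
      have hs := hsq q.2 h2 h3
      have h4 : N * M / (δ / 4) ^ 2 * (δ / 4) ^ 2 = N * M := by field_simp
      have h5 : 2 * θ * q.2 ≤ 2 * θ * (2 * (ε * δ)) := by gcongr
      simp only [quadBarrier, h1, zero_apply]
      nlinarith)
    (fun x hx => by
      have := hlow x hx
      have h6 : 0 ≤ N * M / (δ / 4) ^ 2 * ‖x - x₀‖ ^ 2 := by positivity
      simp only [quadBarrier, zero_apply]
      nlinarith)
    (fun x hx _ => by
      obtain ⟨D, hD, hDθ⟩ := hF x (by linarith)
      exact ⟨-1 * D, by linarith [(abs_le.1 hDθ).1], hD.const_mul (-1)⟩)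
    (q := (x₀, y₀)) (by simp; linarith) hy₀ (by simp only; linarith)
  simp only [quadBarrier, zero_apply, sub_self, norm_zero, h₀] at key
  have h7 : N * M / (δ / 4) ^ 2 * (d + 1) * (2 * (ε * δ)) ^ 2 = M * (N * (d + 1) * (64 * ε ^ 2)) := by
    field_simp; ring
  have h8 := mul_le_mul_of_nonneg_left (liftRate_mul_sq_le d) hMpos.le
  rw [← hεdef, ← hN] at h8
  have h9 : 0 ≤ N * M / (δ / 4) ^ 2 * ((d + 1) * y₀ ^ 2) := by positivity
  have h10 : θ * (ε * δ) ≤ θ * (1 / 32) := by gcongr; linarith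
  have h11 : 0 ≤ θ * y₀ := by positivity
  nlinarith

/-- Side of a box, relative to the distance to the boundary, on which a harmonic function stays
above half of its value at a corner. -/
noncomputable def boxRate (d : ℕ) : ℝ := liftRate d / (4 * 2 ^ (d + 1) * (16 * d + 52))

theorem boxRate_pos (d : ℕ) : 0 < boxRate d := by
  have := liftRate_pos d
  unfold boxRate
  positivity

theorem boxRate_le (d : ℕ) : boxRate d ≤ liftRate d / 4 := by
  have := liftRate_pos d
  have h1 : (1 : ℝ) ≤ 2 ^ (d + 1) := one_le_pow₀ (by norm_num)
  have h2 : (0 : ℝ) ≤ d := d.cast_nonneg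
  unfold boxRate
  gcongr
  nlinarith

theorem sqDist_le_imp {d : ℕ} {m : Esp d} {yt ρ : ℝ} {q : Esp d × ℝ} (hρ : 0 ≤ ρ)
    (h : sqDist m yt q ≤ ρ ^ 2) : ‖q.1 - m‖ ≤ ρ ∧ |q.2 - yt| ≤ ρ := by
  unfold sqDist at h
  exact ⟨(sq_le_sq₀ (norm_nonneg _) hρ).1 (by nlinarith [sq_nonneg (q.2 - yt)]),
    abs_le_of_sq_le_sq (by nlinarith [sq_nonneg ‖q.1 - m‖]) hρ⟩

theorem le_on_box {d : ℕ} {u : Esp d × ℝ → ℝ} {x₁ : Esp d} {y₁ δ M : ℝ}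
    (hδ : 0 < δ) (hM : 0 < M) (hy₁ : liftRate d * δ ≤ y₁)
    (hlap : ∀ q : Esp d × ℝ, ‖q.1 - x₁‖ ≤ δ / 4 → 0 < q.2 → q.2 ≤ y₁ + δ / 4 →
      HasLaplacian u q 0)
    (hc : ContinuousOn u {q | ‖q.1 - x₁‖ ≤ δ / 4 ∧ 0 ≤ q.2 ∧ q.2 ≤ y₁ + δ / 4})
    (hu : ∀ q : Esp d × ℝ, ‖q.1 - x₁‖ ≤ δ / 4 → 0 ≤ q.2 → q.2 ≤ y₁ + δ / 4 →
      |u q| ≤ 2 ^ (d + 1) * M)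
    (h₁ : M / 2 ≤ u (x₁, y₁)) {x : Esp d} {y : ℝ} (hx : ‖x - x₁‖ ≤ boxRate d * δ)
    (hy : y₁ ≤ y) (hy' : y ≤ y₁ + boxRate d * δ) : M / 4 ≤ u (x, y) := by
  have hε := liftRate_pos d
  have hε32 := liftRate_le d
  have hbε := boxRate_le d
  have hbpos := boxRate_pos d
  have hbdef : boxRate d * (4 * 2 ^ (d + 1) * (16 * d + 52)) = liftRate d := by
    unfold boxRate; field_simp
  set ε := liftRate d with hεdef
  set N : ℝ := 2 ^ (d + 1) with hN
  set b := boxRate d with hb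
  have hNpos : 0 < N := by positivity
  have hεδ0 : 0 < ε * δ := by positivity
  have hεδ : ε * δ ≤ δ / 32 := by nlinarith
  have hbδ : b * δ ≤ ε * δ / 4 := by nlinarith
  set ρ := ε * δ / 2 with hρ
  have hρ0 : 0 < ρ := by positivity
  have hsub : ∀ (m : Esp d) (yt : ℝ), ‖m - x₁‖ ≤ ρ → y₁ ≤ yt → yt ≤ y₁ + ρ →
      ∀ q : Esp d × ℝ, sqDist m yt q ≤ ρ ^ 2 →
        ‖q.1 - x₁‖ ≤ δ / 4 ∧ 0 < q.2 ∧ q.2 ≤ y₁ + δ / 4 := by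
    intro m yt hm h1 h2 q hq
    obtain ⟨h3, h4⟩ := sqDist_le_imp hρ0.le hq
    have h5 := abs_le.1 h4
    have h6 := norm_sub_le_norm_sub_add_norm_sub q.1 m x₁
    exact ⟨by linarith, by linarith, by linarith⟩
  have hmid : ‖(1 / 2 : ℝ) • (x₁ + x) - x₁‖ ≤ ρ := by
    have : (1 / 2 : ℝ) • (x₁ + x) - x₁ = (1 / 2 : ℝ) • (x - x₁) := by module
    rw [this, norm_smul]
    norm_num
    linarith
  have ht := tangential_lipschitz (v := u) (F := fun _ => 0) (x := x₁) (x' := x) (yt := y₁)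
    (ρ := ρ) (M := N * M) (Λ := 1 / (8 * ρ)) (P := 0) rfl (by linarith) hρ0 (by positivity)
    (by field_simp; rfl) (by positivity) le_rfl
    (hc.mono fun q hq => by
      obtain ⟨a1, a2, a3⟩ := hsub _ _ hmid le_rfl (by linarith) q hq.1
      exact ⟨a1, a2.le, a3⟩)
    (fun q hq h0 => by
      obtain ⟨a1, a2, a3⟩ := hsub _ _ hmid le_rfl (by linarith) q hq
      exact hu q a1 h0 a3)
    (fun q hq h0 => by
      obtain ⟨a1, a2, a3⟩ := hsub _ _ hmid le_rfl (by linarith) q hq.le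
      exact hlap q a1 h0 a3)
    (fun z hz => absurd (hsub _ _ hmid le_rfl (by linarith) _ hz.le).2.1 (lt_irrefl _))
    (fun z z' hz => absurd (hsub _ _ hmid le_rfl (by linarith) _ hz.le).2.1 (lt_irrefl _))
    (by rw [norm_sub_rev]; linarith)
  have hxρ : ‖x - x₁‖ ≤ ρ := by linarith
  have hv := vertical_lipschitz (v := fun q => -1 * u q) (x := x) (yt := (y + y₁) / 2) (ρ := ρ)
    (M := N * M) (s := (y - y₁) / 2) hρ0 (by linarith) (by positivity)
    (continuousOn_const.mul (hc.mono fun q hq => by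
      obtain ⟨a1, a2, a3⟩ := hsub x ((y + y₁) / 2) hxρ (by linarith) (by linarith) q hq.1
      exact ⟨a1, a2.le, a3⟩))
    (fun q hq h0 => by
      obtain ⟨a1, a2, a3⟩ := hsub x ((y + y₁) / 2) hxρ (by linarith) (by linarith) q hq
      simpa using hu q a1 h0 a3)
    (fun q hq h0 => by
      obtain ⟨a1, a2, a3⟩ := hsub x ((y + y₁) / 2) hxρ (by linarith) (by linarith) q hq.le
      simpa using (hlap q a1 h0 a3).const_mul (-1))
    (by linarith) (by linarith)
  rw [show (y + y₁) / 2 + (y - y₁) / 2 = y by ring,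
    show (y + y₁) / 2 - (y - y₁) / 2 = y₁ by ring] at hv
  rw [norm_sub_rev] at ht
  have hb1 : ((4 * d + 13) * (N * M) / ρ + 2 * 0) * ‖x - x₁‖
      ≤ ((4 * d + 13) * (N * M) / ρ + 2 * 0) * (b * δ) := by gcongr
  have hb2 : (8 * d + 26) * (N * M) / ρ * ((y - y₁) / 2)
      ≤ (8 * d + 26) * (N * M) / ρ * (b * δ / 2) := by gcongr; linarith
  have hb3 : ((4 * d + 13) * (N * M) / ρ + 2 * 0) * (b * δ)
      + (8 * d + 26) * (N * M) / ρ * (b * δ / 2) = M / 4 := by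
    rw [hρ, ← hbdef]
    field_simp
    ring
  linarith

/-- Bound for the supremum of a harmonic function weighted by a power of the distance to the
boundary. -/
noncomputable def weightedBound (d : ℕ) (θ A : ℝ) : ℝ :=
  max (16 * θ) (√(16 * A ^ 2 /
    (volume.real (Metric.ball (0 : Esp d) 1) * boxRate d ^ (d + 1))))

theorem volume_real_box {d : ℕ} (x₁ : Esp d) (y₁ : ℝ) {s : ℝ} (hs : 0 ≤ s) :
    volume.real (Metric.closedBall x₁ s ×ˢ Icc y₁ (y₁ + s)) =
      volume.real (Metric.ball (0 : Esp d) 1) * s ^ (d + 1) := by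
  rw [Measure.volume_eq_prod, measureReal_prod_prod, Measure.addHaar_real_closedBall _ _ hs,
    Real.volume_real_Icc_of_le (by linarith)]
  simp
  ring

theorem sq_mul_volume_le {d : ℕ} {u : Esp d × ℝ → ℝ} {x₁ : Esp d} {y₁ s A M : ℝ}
    (hs : 0 ≤ s) (hM : 0 ≤ M)
    (hint : IntegrableOn (fun p => (u p) ^ 2) (upBall d 1) volume)
    (hA : (∫ p in upBall d 1, (u p) ^ 2) ≤ A ^ 2)
    (hsub : Metric.closedBall x₁ s ×ˢ Icc y₁ (y₁ + s) ⊆ upBall d 1)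
    (hlow : ∀ q ∈ Metric.closedBall x₁ s ×ˢ Icc y₁ (y₁ + s), M ≤ u q) :
    M ^ 2 * (volume.real (Metric.ball (0 : Esp d) 1) * s ^ (d + 1)) ≤ A ^ 2 := by
  have hcpt : IsCompact (Metric.closedBall x₁ s ×ˢ Icc y₁ (y₁ + s)) :=
    (isCompact_closedBall x₁ s).prod isCompact_Icc
  rw [← volume_real_box x₁ y₁ hs, mul_comm, ← smul_eq_mul, ← setIntegral_const]
  refine ((setIntegral_mono_on (integrableOn_const hcpt.measure_lt_top.ne)
    (hint.mono_set hsub) hcpt.measurableSet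
    fun q hq => pow_le_pow_left₀ hM (hlow q hq) 2).trans ?_).trans hA
  exact setIntegral_mono_set hint (Filter.Eventually.of_forall fun q => sq_nonneg _)
    hsub.eventuallyLE

theorem integrableOn_sq_of_add {d : ℕ} {u : Esp d × ℝ → ℝ} (hc : ContinuousOn u (upBall d 1))
    (h : IntegrableOn (fun p => (u p) ^ 2 + gradSqH d u p) (upBall d 1) volume) :
    IntegrableOn (fun p => (u p) ^ 2) (upBall d 1) volume := by
  refine Integrable.mono h
    ((hc.pow 2).aestronglyMeasurable (isOpen_upBall d 1).measurableSet)
    (Filter.Eventually.of_forall fun q => ?_)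
  have hg : 0 ≤ gradSqH d u q :=
    add_nonneg (Finset.sum_nonneg fun i _ => sq_nonneg _) (sq_nonneg _)
  rw [Real.norm_of_nonneg (sq_nonneg _), Real.norm_of_nonneg (by positivity)]
  linarith

section

variable {d : ℕ} {u : Esp d × ℝ → ℝ} {θ A : ℝ}

theorem weighted_le {x₀ : Esp d} {y₀ δ : ℝ} (hθ : 0 < θ)
    (hc : ContinuousOn u {q | ‖q.1‖ ^ 2 + q.2 ^ 2 < 1 ∧ 0 ≤ q.2})
    (hlap : ∀ q : Esp d × ℝ, ‖q.1‖ ^ 2 + q.2 ^ 2 < 1 → 0 < q.2 → HasLaplacian u q 0)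
    (hF : ∀ x : Esp d, ‖x‖ < 1 → ∃ D, NormalDeriv d u x D ∧ |D| ≤ θ)
    (hint : IntegrableOn (fun p => (u p) ^ 2) (upBall d 1) volume)
    (hA : (∫ p in upBall d 1, (u p) ^ 2) ≤ A ^ 2)
    (hδ : 0 < δ) (hxδ : ‖x₀‖ + δ ≤ 3 / 4) (hy₀ : 0 ≤ y₀) (hyδ : y₀ + δ ≤ 1 / 4)
    (hpos : 0 < u (x₀, y₀))
    (hu : ∀ q : Esp d × ℝ, ‖q.1 - x₀‖ ≤ δ / 2 → 0 ≤ q.2 → q.2 ≤ y₀ + δ / 2 →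
      |u q| ≤ 2 ^ (d + 1) * u (x₀, y₀)) :
    δ ^ (d + 1) * u (x₀, y₀) ≤ weightedBound d θ A := by
  have hb := boxRate_pos d
  have hbε := boxRate_le d
  have hε := liftRate_le d
  have hω : 0 < volume.real (Metric.ball (0 : Esp d) 1) :=
    ENNReal.toReal_pos (Metric.measure_ball_pos _ _ one_pos).ne' measure_ball_lt_top.ne
  set M := u (x₀, y₀)
  have hδ1 : δ ≤ 1 := by linarith
  have hδk : δ ^ (d + 1) ≤ 1 := pow_le_one₀ hδ.le hδ1
  rcases lt_or_ge M (16 * θ) with hcase | hcase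
  · refine le_max_of_le_left ?_
    calc δ ^ (d + 1) * M ≤ 1 * M := by gcongr
      _ ≤ 16 * θ := by linarith
  refine le_max_of_le_right (Real.le_sqrt_of_sq_le ?_)
  have hregion : ∀ q : Esp d × ℝ, ‖q.1 - x₀‖ ≤ δ / 2 → 0 ≤ q.2 → q.2 ≤ y₀ + δ / 2 →
      ‖q.1‖ ^ 2 + q.2 ^ 2 < 1 := by
    intro q h1 h2 h3
    have h4 := norm_le_norm_add_norm_sub' q.1 x₀
    have h5 : ‖q.1‖ ≤ 3 / 4 := by linarith
    have h6 : q.2 ≤ 1 / 4 := by linarith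
    nlinarith [norm_nonneg q.1]
  have hx₀ : ∀ x, ‖x - x₀‖ ≤ δ / 2 → ‖x‖ < 1 := fun x hx => by
    have h4 := norm_le_norm_add_norm_sub' x x₀
    linarith
  have hcont : ContinuousOn u {q | ‖q.1 - x₀‖ ≤ δ / 2 ∧ 0 ≤ q.2 ∧ q.2 ≤ y₀ + δ / 2} :=
    hc.mono fun q hq => ⟨hregion q hq.1 hq.2.1 hq.2.2, hq.2.1⟩
  obtain ⟨x₁, y₁, hx₁, hy₁, hy₁', h₁⟩ := exists_high_point hy₀ hδ hδ1 hθ hcase hcont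
    (fun q h1 h2 h3 => hlap q (hregion q h1 h2.le h3) h2) (fun x hx => hF x (hx₀ x hx)) hu rfl
  have htri : ∀ q : Esp d × ℝ, ‖q.1 - x₁‖ ≤ δ / 4 → ‖q.1 - x₀‖ ≤ δ / 2 := fun q hq => by
    have := norm_sub_le_norm_sub_add_norm_sub q.1 x₁ x₀
    linarith
  have hbδ : boxRate d * δ ≤ δ / 4 := by nlinarith
  have hy₁pos : 0 < y₁ := lt_of_lt_of_le (mul_pos (liftRate_pos d) hδ) hy₁
  have hvol := sq_mul_volume_le (u := u) (x₁ := x₁) (y₁ := y₁) (s := boxRate d * δ) (A := A)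
    (M := M / 4) (by positivity) (by positivity) hint hA
    (fun q hq => by
      have h1 := mem_closedBall_iff_norm.1 hq.1
      have h2 : y₁ ≤ q.2 ∧ q.2 ≤ y₁ + boxRate d * δ := hq.2
      exact ⟨by rw [one_pow]; exact hregion q (htri q (by linarith)) (by linarith) (by linarith),
        by linarith⟩)
    (fun q hq => le_on_box hδ hpos hy₁
      (fun q h1 h2 h3 => hlap q (hregion q (htri q h1) h2.le (by linarith)) h2)
      (hcont.mono fun q hq => ⟨htri q hq.1, hq.2.1, by linarith [hq.2.2]⟩)
      (fun q h1 h2 h3 => hu q (htri q h1) h2 (by linarith)) h₁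
      (mem_closedBall_iff_norm.1 hq.1) hq.2.1 hq.2.2)
  rw [le_div_iff₀ (by positivity)]
  set ω := volume.real (Metric.ball (0 : Esp d) 1)
  have e1 : (M / 4) ^ 2 * (ω * (boxRate d * δ) ^ (d + 1))
      = (M ^ 2 * δ ^ (d + 1) * (ω * boxRate d ^ (d + 1))) / 16 := by rw [mul_pow]; ring
  rw [e1] at hvol
  have e2 : (δ ^ (d + 1) * M) ^ 2 * (ω * boxRate d ^ (d + 1))
      = δ ^ (d + 1) * (M ^ 2 * δ ^ (d + 1) * (ω * boxRate d ^ (d + 1))) := by ring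
  have e3 : 0 ≤ M ^ 2 * δ ^ (d + 1) * (ω * boxRate d ^ (d + 1)) := by positivity
  rw [e2]
  nlinarith

theorem abs_le_of_integral_sq_le (hθ : 0 < θ)
    (hc : ContinuousOn u {q | ‖q.1‖ ^ 2 + q.2 ^ 2 < 1 ∧ 0 ≤ q.2})
    (hlap : ∀ q : Esp d × ℝ, ‖q.1‖ ^ 2 + q.2 ^ 2 < 1 → 0 < q.2 → HasLaplacian u q 0)
    (hF : ∀ x : Esp d, ‖x‖ < 1 → ∃ D, NormalDeriv d u x D ∧ |D| ≤ θ)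
    (hint : IntegrableOn (fun p => (u p) ^ 2) (upBall d 1) volume)
    (hA : (∫ p in upBall d 1, (u p) ^ 2) ≤ A ^ 2) {q : Esp d × ℝ}
    (hq1 : ‖q.1‖ ≤ 5 / 8) (hq2 : 0 ≤ q.2) (hq3 : q.2 ≤ 1 / 8) :
    |u q| ≤ 8 ^ (d + 1) * weightedBound d θ A := by
  set T : Set (Esp d × ℝ) := Metric.closedBall 0 (3 / 4) ×ˢ Icc 0 (1 / 4) with hT
  set D : Esp d × ℝ → ℝ := fun p => min (3 / 4 - ‖p.1‖) (1 / 4 - p.2) with hD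
  have hDc : Continuous D := by fun_prop
  have hTmem : ∀ p : Esp d × ℝ, p ∈ T ↔ ‖p.1‖ ≤ 3 / 4 ∧ 0 ≤ p.2 ∧ p.2 ≤ 1 / 4 := fun p => by
    simp [hT, Set.mem_prod]
  have hTc : IsCompact T := (isCompact_closedBall _ _).prod isCompact_Icc
  have hTsub : T ⊆ {q | ‖q.1‖ ^ 2 + q.2 ^ 2 < 1 ∧ 0 ≤ q.2} := fun p hp => by
    obtain ⟨h1, h2, h3⟩ := (hTmem p).1 hp
    exact ⟨by nlinarith [norm_nonneg p.1], h2⟩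
  have hqT : q ∈ T := (hTmem q).2 ⟨by linarith, hq2, by linarith⟩
  obtain ⟨p, hpT, hmax⟩ := hTc.exists_isMaxOn (f := fun p => D p ^ (d + 1) * |u p|) ⟨q, hqT⟩
    ((hDc.pow _).continuousOn.mul (hc.mono hTsub).abs)
  have hmax : ∀ p' ∈ T, D p' ^ (d + 1) * |u p'| ≤ D p ^ (d + 1) * |u p| := hmax
  have hW : 0 ≤ weightedBound d θ A := le_max_of_le_left (by linarith)
  have hD0 : 0 ≤ D p := by
    obtain ⟨h1, h2, h3⟩ := (hTmem p).1 hpT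
    exact le_min (by linarith) (by linarith)
  have hp : D p ^ (d + 1) * |u p| ≤ weightedBound d θ A := by
    rcases hD0.eq_or_lt with h0 | hDp
    · rw [← h0, zero_pow (by omega), zero_mul]; exact hW
    rcases eq_or_ne (u p) 0 with h0 | h0
    · rw [h0, abs_zero, mul_zero]; exact hW
    obtain ⟨h1, h2, h3⟩ := (hTmem p).1 hpT
    have hDx : D p ≤ 3 / 4 - ‖p.1‖ := min_le_left _ _
    have hDy : D p ≤ 1 / 4 - p.2 := min_le_right _ _
    have hnear : ∀ q : Esp d × ℝ, ‖q.1 - p.1‖ ≤ D p / 2 → 0 ≤ q.2 → q.2 ≤ p.2 + D p / 2 →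
        |u q| ≤ 2 ^ (d + 1) * |u p| := by
      intro q h4 h5 h6
      have h7 := norm_le_norm_add_norm_sub' q.1 p.1
      have hDq : D p / 2 ≤ D q := le_min (by linarith) (by linarith)
      have h8 := hmax q ((hTmem q).2 ⟨by linarith, h5, by linarith⟩)
      have h9 : (D p / 2) ^ (d + 1) * |u q| ≤ D q ^ (d + 1) * |u q| := by gcongr
      have h10 : (D p / 2) ^ (d + 1) * |u q| ≤ (D p / 2) ^ (d + 1) * (2 ^ (d + 1) * |u p|) := by
        calc _ ≤ D p ^ (d + 1) * |u p| := h9.trans h8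
          _ = _ := by rw [← mul_assoc, ← mul_pow]; congr 2; ring
      exact le_of_mul_le_mul_left h10 (by positivity)
    rcases lt_or_gt_of_ne h0 with hneg | hpos
    · have habs := abs_of_neg hneg
      have := weighted_le (u := fun q => -1 * u q) (x₀ := p.1) (y₀ := p.2) (δ := D p) (A := A) hθ
        (continuousOn_const.mul hc) (fun q h1 h2 => by simpa using (hlap q h1 h2).const_mul (-1))
        (fun x hx => by
          obtain ⟨E, hE, hEθ⟩ := hF x hx
          exact ⟨-1 * E, hE.const_mul (-1), by simpa using hEθ⟩)
        (by simpa using hint) (by simpa using hA) hDp (by linarith) h2 (by linarith)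
        (by simpa using hneg)
        (fun q h4 h5 h6 => by simpa [habs] using hnear q h4 h5 h6)
      rw [habs]
      simpa using this
    · have habs := abs_of_pos hpos
      rw [habs] at hnear ⊢
      exact weighted_le hθ hc hlap hF hint hA hDp (by linarith) h2 (by linarith) hpos hnear
  have hDq : 1 / 8 ≤ D q := le_min (by linarith) (by linarith)
  have h1 : (1 / 8 : ℝ) ^ (d + 1) * |u q| ≤ D q ^ (d + 1) * |u q| := by gcongr
  have h2 := (h1.trans (hmax q hqT)).trans hp
  calc |u q| = 8 ^ (d + 1) * ((1 / 8 : ℝ) ^ (d + 1) * |u q|) := by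
        rw [← mul_assoc, ← mul_pow]; norm_num
    _ ≤ _ := by gcongr

end

/-- A harmonic function in the half ball whose boundary flux `F` obeys the two-phase law
relative to the obstacle `φ`. -/
structure FluxSol {d : ℕ} (u : Esp d × ℝ → ℝ) (φ F : Esp d → ℝ) (Λ θ : ℝ) : Prop where
  cont : ContinuousOn u {q | ‖q.1‖ ^ 2 + q.2 ^ 2 < 1 ∧ 0 ≤ q.2}
  lap : ∀ q : Esp d × ℝ, ‖q.1‖ ^ 2 + q.2 ^ 2 < 1 → 0 < q.2 → HasLaplacian u q 0
  flux : ∀ x, ‖x‖ < 1 → NormalDeriv d u x (F x)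
  flux_abs : ∀ x, ‖x‖ < 1 → |F x| ≤ θ
  flux_pos : ∀ x, ‖x‖ < 1 → φ x < u (x, 0) → θ - Λ * (u (x, 0) - φ x) ≤ F x
  flux_neg : ∀ x, ‖x‖ < 1 → u (x, 0) < φ x → F x ≤ -θ + Λ * (φ x - u (x, 0))
  flux_mono : ∀ x x', ‖x‖ < 1 → ‖x'‖ < 1 → u (x', 0) - φ x' < u (x, 0) - φ x →
    -Λ * ((u (x, 0) - φ x) - (u (x', 0) - φ x')) ≤ F x - F x'

theorem TwoPhaseSolH.exists_fluxSol {d : ℕ} {θ L Λ : ℝ} {f : ℝ → ℝ} {φ : Esp d → ℝ}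
    {u : Esp d × ℝ → ℝ} (hu : TwoPhaseSolH d θ f φ u) (hf : GoodF θ L f) (hLΛ : L ≤ Λ)
    (hΛ : 0 ≤ Λ) : ∃ F : Esp d → ℝ, FluxSol u φ F Λ θ := by
  obtain ⟨hc, hh, hb⟩ := hu
  obtain ⟨hf0, hfθ, hfL⟩ := hf
  choose! F hFd hFθ hFf using hb
  have hf' : ∀ s t : ℝ, 0 ≤ s → 0 ≤ t → |f s - f t| ≤ Λ * |s - t| := fun s t h1 h2 =>
    (hfL s t h1 h2).trans (by gcongr)
  have hp : ∀ x, ‖x‖ < 1 → φ x < u (x, 0) → F x = f (u (x, 0) - φ x) := fun x hx h => by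
    rw [hFf x hx h.ne', abs_of_pos (sub_pos.2 h), Real.sign_of_pos (sub_pos.2 h), mul_one]
  have hn : ∀ x, ‖x‖ < 1 → u (x, 0) < φ x → F x = -f (φ x - u (x, 0)) := fun x hx h => by
    rw [hFf x hx h.ne, abs_of_neg (sub_neg.2 h), Real.sign_of_neg (sub_neg.2 h), neg_sub]
    ring
  have hpos : ∀ x, ‖x‖ < 1 → φ x < u (x, 0) → θ - Λ * (u (x, 0) - φ x) ≤ F x := by
    intro x hx h
    have h1 := (abs_le.1 (hf' _ 0 (sub_pos.2 h).le le_rfl)).1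
    rw [sub_zero, abs_of_pos (sub_pos.2 h), hf0] at h1
    rw [hp x hx h]
    linarith
  have hneg : ∀ x, ‖x‖ < 1 → u (x, 0) < φ x → F x ≤ -θ + Λ * (φ x - u (x, 0)) := by
    intro x hx h
    have h1 := (abs_le.1 (hf' _ 0 (sub_pos.2 h).le le_rfl)).1
    rw [sub_zero, abs_of_pos (sub_pos.2 h), hf0] at h1
    rw [hn x hx h]
    linarith
  have hset : upBall d 1 ∪ flatBall d 1 = {q | ‖q.1‖ ^ 2 + q.2 ^ 2 < 1 ∧ 0 ≤ q.2} := by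
    ext q
    simp only [upBall, flatBall, one_pow, mem_union, mem_ofPred_eq, le_iff_lt_or_eq, eq_comm]
    tauto
  refine ⟨F, hset ▸ hc, fun q h1 h2 => hh.hasLaplacian ⟨by simpa using h1, h2⟩, hFd, hFθ, hpos,
    hneg, ?_⟩
  intro x x' hx hx' h
  have hΛh : 0 ≤ Λ * ((u (x, 0) - φ x) - (u (x', 0) - φ x')) :=
    mul_nonneg hΛ (sub_nonneg.2 h.le)
  have ha := abs_le.1 (hFθ x hx)
  have ha' := abs_le.1 (hFθ x' hx')
  rcases lt_or_ge (φ x) (u (x, 0)) with hw | hw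
  · rcases lt_or_ge (φ x') (u (x', 0)) with hw' | hw'
    · rw [hp x hx hw, hp x' hx' hw']
      have h1 := (abs_le.1 (hf' _ _ (sub_pos.2 hw).le (sub_pos.2 hw').le)).1
      rw [abs_of_pos (sub_pos.2 h)] at h1
      linarith
    · have h1 := hpos x hx hw
      nlinarith [mul_nonneg hΛ (sub_nonneg.2 hw')]
  · have hw' : u (x', 0) < φ x' := by linarith
    rcases hw.lt_or_eq with hw | hw
    · rw [hn x hx hw, hn x' hx' hw']
      have h1 := (abs_le.1 (hf' _ _ (sub_pos.2 hw').le (sub_pos.2 hw).le)).1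
      rw [abs_of_pos (by linarith)] at h1
      linarith
    · have h1 := hneg x' hx' hw'
      rw [hw, sub_self]
      linarith

section C11Bound

variable {d : ℕ} {P : ℝ} {φ : Esp d → ℝ}

theorem C11Bound.nonneg (h : C11Bound d P φ) : 0 ≤ P :=
  (abs_nonneg _).trans (h.1 0 (by simp)).2.1

theorem C11Bound.lipschitz (h : C11Bound d P φ) {x x' : Esp d} (hx : ‖x‖ < 1) (hx' : ‖x'‖ < 1) :
    |φ x - φ x'| ≤ P * ‖x - x'‖ :=
  (convex_ball (0 : Esp d) 1).norm_image_sub_le_of_norm_fderiv_le (𝕜 := ℝ)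
    (fun z hz => (h.1 z (mem_ball_zero_iff.1 hz)).1)
    (fun z hz => (h.1 z (mem_ball_zero_iff.1 hz)).2.2)
    (mem_ball_zero_iff.2 hx') (mem_ball_zero_iff.2 hx)

theorem C11Bound.taylor (h : C11Bound d P φ) {x x' y : Esp d} {r : ℝ} (hx : ‖x‖ < 1)
    (hx' : ‖x'‖ < 1) (hy : ‖y‖ < 1) (hyr : ∀ z ∈ segment ℝ x x', ‖z - y‖ ≤ r) :
    |φ x' - φ x - fderiv ℝ φ y (x' - x)| ≤ P * r * ‖x' - x‖ := by
  have hseg : ∀ z ∈ segment ℝ x x', ‖z‖ < 1 := fun z hz => mem_ball_zero_iff.1 <|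
    (convex_ball (0 : Esp d) 1).segment_subset (mem_ball_zero_iff.2 hx) (mem_ball_zero_iff.2 hx') hz
  exact (convex_segment x x').norm_image_sub_le_of_norm_fderiv_le' (𝕜 := ℝ)
    (fun z hz => (h.1 z (hseg z hz)).1)
    (fun z hz => (h.2 z y (hseg z hz) hy).trans
      (mul_le_mul_of_nonneg_left (hyr z hz) h.nonneg))
    (left_mem_segment ℝ x x') (right_mem_segment ℝ x x')

end C11Bound

/-- The blow-up at `(x₀, 0)` of `u` minus the affine part of the obstacle. -/
noncomputable def blowUp {d : ℕ} (u : Esp d × ℝ → ℝ) (φ : Esp d → ℝ) (x₀ : Esp d) (R : ℝ)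
    (q : Esp d × ℝ) : ℝ :=
  R⁻¹ * (u (x₀ + R • q.1, R * q.2) - φ x₀) - fderiv ℝ φ x₀ q.1

/-- The blow-up at `x₀` of the obstacle minus its affine part. -/
noncomputable def obstBlowUp {d : ℕ} (φ : Esp d → ℝ) (x₀ : Esp d) (R : ℝ) (x : Esp d) : ℝ :=
  R⁻¹ * (φ (x₀ + R • x) - φ x₀) - fderiv ℝ φ x₀ x

section blowUp

variable {d : ℕ} {u : Esp d × ℝ → ℝ} {φ F : Esp d → ℝ} {Λ θ P R : ℝ} {x₀ : Esp d}

theorem blowUp_sub_obstBlowUp (x : Esp d) :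
    blowUp u φ x₀ R (x, 0) - obstBlowUp φ x₀ R x
      = R⁻¹ * (u (x₀ + R • x, 0) - φ (x₀ + R • x)) := by
  simp only [blowUp, obstBlowUp, mul_zero]
  ring

theorem norm_add_smul_lt {x : Esp d} {r : ℝ} (hR : 0 < R) (hx : ‖x‖ < r) :
    ‖x₀ + R • x‖ < ‖x₀‖ + R * r := by
  refine (norm_add_le _ _).trans_lt ?_
  rw [norm_smul, Real.norm_of_nonneg hR.le]
  gcongr

theorem FluxSol.thinSol_blowUp (h : FluxSol u φ F Λ θ) (hφ : C11Bound d P φ) (hR : 0 < R)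
    (hR' : R ≤ 1 / 4) (hx₀ : ‖x₀‖ ≤ 17 / 32) :
    ThinSol (blowUp u φ x₀ R) (obstBlowUp φ x₀ R) (fun x => F (x₀ + R • x))
      (fun x => fderiv ℝ φ (x₀ + R • x) - fderiv ℝ φ x₀) (P * R) (Λ * R) θ := by
  have hP := hφ.nonneg
  have hin : ∀ x : Esp d, ‖x‖ < 1 → ‖x₀ + R • x‖ < 25 / 32 := fun x hx => by
    have := norm_add_smul_lt (x₀ := x₀) hR hx
    linarith
  have hin1 : ∀ x : Esp d, ‖x‖ < 1 → ‖x₀ + R • x‖ < 1 := fun x hx => by linarith [hin x hx]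
  have hx₀1 : ‖x₀‖ < 1 := by linarith
  have hreg : ∀ q : Esp d × ℝ, ‖q.1‖ < 1 → 0 ≤ q.2 → q.2 < 1 →
      ‖x₀ + R • q.1‖ ^ 2 + (R * q.2) ^ 2 < 1 := fun q h1 h2 h3 => by
    have h4 := hin q.1 h1
    have h5 : R * q.2 ≤ 1 / 4 * 1 := by gcongr
    have h6 : 0 ≤ R * q.2 := by positivity
    nlinarith [norm_nonneg (x₀ + R • q.1)]
  have hdist : ∀ x : Esp d, ‖x₀ + R • x - x₀‖ = R * ‖x‖ := fun x => by
    rw [add_sub_cancel_left, norm_smul, Real.norm_of_nonneg hR.le]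
  have hdiff : ∀ x x' : Esp d, (x₀ + R • x) - (x₀ + R • x') = R • (x - x') := fun x x' => by module
  have hRinv : R⁻¹ * R = 1 := inv_mul_cancel₀ hR.ne'
  have hgap : ∀ x, blowUp u φ x₀ R (x, 0) - obstBlowUp φ x₀ R x
      = R⁻¹ * (u (x₀ + R • x, 0) - φ (x₀ + R • x)) := blowUp_sub_obstBlowUp
  have hΛgap : ∀ t, Λ * R * (R⁻¹ * t) = Λ * t := fun t => by field_simp
  refine ⟨?_, ?_, ?_, ?_, ?_, ?_, ?_, ?_, ?_⟩
  · refine (continuousOn_const.mul (ContinuousOn.sub ?_ continuousOn_const)).sub (by fun_prop)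
    exact h.cont.comp (by fun_prop) fun q hq => ⟨hreg q hq.1 hq.2.1 hq.2.2,
      mul_nonneg hR.le hq.2.1⟩
  · intro q h1 h2 h3
    have h4 := (h.lap (x₀ + R • q.1, R * q.2) (hreg q h1 h2.le h3)
      (mul_pos hR h2)).comp_dilation R x₀
    exact (((h4.sub (.const (φ x₀))).const_mul R⁻¹).sub (.clm (fderiv ℝ φ x₀))).congr
      (fun _ => rfl) (by ring)
  · intro x hx
    have h1 : Filter.Tendsto (fun t : ℝ => R * t) (𝓝[>] 0) (𝓝[>] 0) :=
      tendsto_nhdsWithin_iff.2 ⟨((continuous_const_mul R).tendsto' 0 0 (mul_zero R)).mono_left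
        nhdsWithin_le_nhds, Filter.eventually_of_mem self_mem_nhdsWithin
          fun t ht => mul_pos hR ht⟩
    refine ((h.flux _ (hin1 x hx)).comp h1).congr fun t => ?_
    simp only [blowUp, Function.comp, mul_zero, div_eq_mul_inv, mul_inv]
    ring
  · intro x hx hlt
    have h1 : 0 < R⁻¹ * (u (x₀ + R • x, 0) - φ (x₀ + R • x)) := by
      rw [← hgap]; exact sub_pos.2 hlt
    rw [hgap, hΛgap]
    exact h.flux_pos _ (hin1 x hx) (sub_pos.1 (pos_of_mul_pos_right h1 (by positivity)))
  · intro x hx hlt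
    have h1 : R⁻¹ * (u (x₀ + R • x, 0) - φ (x₀ + R • x)) < 0 := by
      rw [← hgap]; exact sub_neg.2 hlt
    have h2 := h.flux_neg _ (hin1 x hx)
      (sub_neg.1 (neg_of_mul_neg_right h1 (by positivity)))
    rw [← neg_sub (blowUp u φ x₀ R (x, 0)), hgap, mul_neg, hΛgap]
    linarith
  · intro x x' hx hx' hlt
    rw [hgap, hgap] at hlt
    have h2 := h.flux_mono _ _ (hin1 x hx) (hin1 x' hx')
      (lt_of_mul_lt_mul_left hlt (by positivity))
    rw [hgap, hgap, ← mul_sub, neg_mul, hΛgap]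
    linarith
  · intro x x' hx hx'
    have h1 := hφ.taylor (x := x₀ + R • x') (x' := x₀ + R • x) (y := x₀) (r := R) (hin1 x' hx')
      (hin1 x hx) hx₀1 fun z hz => by
        have := (convex_closedBall x₀ R).segment_subset
          (x := x₀ + R • x') (y := x₀ + R • x)
          (mem_closedBall_iff_norm.2 (by rw [hdist]; nlinarith))
          (mem_closedBall_iff_norm.2 (by rw [hdist]; nlinarith)) hz
        exact mem_closedBall_iff_norm.1 this
    have h2 : obstBlowUp φ x₀ R x - obstBlowUp φ x₀ R x' = R⁻¹ *
        (φ (x₀ + R • x) - φ (x₀ + R • x')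
          - fderiv ℝ φ x₀ ((x₀ + R • x) - (x₀ + R • x'))) := by
      rw [hdiff, map_smul, smul_eq_mul, map_sub]
      simp only [obstBlowUp]
      field_simp
      ring
    rw [h2, abs_mul, abs_of_pos (inv_pos.2 hR)]
    calc _ ≤ R⁻¹ * (P * R * ‖(x₀ + R • x) - (x₀ + R • x')‖) := by gcongr
      _ = P * R * ‖x - x'‖ := by
        rw [hdiff, norm_smul, Real.norm_of_nonneg hR.le]; field_simp
  · intro x hx
    refine (hφ.2 _ _ (hin1 x hx) hx₀1).trans ?_
    rw [hdist]
    nlinarith [mul_nonneg hP hR.le]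
  · intro x x' hx hx'
    have h1 := hφ.taylor (x := x₀ + R • x) (x' := x₀ + R • x') (y := x₀ + R • x)
      (r := R * ‖x' - x‖) (hin1 x hx) (hin1 x' hx') (hin1 x hx) fun z hz => by
        have := norm_sub_le_of_mem_segment hz
        rwa [hdiff, norm_smul, Real.norm_of_nonneg hR.le] at this
    have h2 : obstBlowUp φ x₀ R x' - obstBlowUp φ x₀ R x
        - (fderiv ℝ φ (x₀ + R • x) - fderiv ℝ φ x₀) (x' - x) = R⁻¹ *
        (φ (x₀ + R • x') - φ (x₀ + R • x)
          - fderiv ℝ φ (x₀ + R • x) ((x₀ + R • x') - (x₀ + R • x))) := by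
      rw [hdiff, map_smul, smul_eq_mul, sub_apply, map_sub (fderiv ℝ φ x₀)]
      simp only [obstBlowUp]
      field_simp
      ring
    rw [h2, abs_mul, abs_of_pos (inv_pos.2 hR)]
    calc _ ≤ R⁻¹ * (P * (R * ‖x' - x‖) * ‖(x₀ + R • x') - (x₀ + R • x)‖) := by gcongr
      _ = P * R * ‖x' - x‖ ^ 2 := by
        rw [hdiff, norm_smul, Real.norm_of_nonneg hR.le]; field_simp

theorem blowUp_zero (h₀ : u (x₀, 0) = φ x₀) : blowUp u φ x₀ R (0, 0) = 0 := by
  simp [blowUp, h₀]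

theorem obstBlowUp_zero : obstBlowUp φ x₀ R 0 = 0 := by
  simp [obstBlowUp]

theorem LipX.blowUp_mul {K lam : ℝ} (h : LipX K (blowUp u φ x₀ R) lam) (hR : 0 < R)
    (hlam : 0 < lam) : LipX K (blowUp u φ x₀ (lam * R)) 1 := by
  intro x x' y hx hx' hy hy1
  have hn : ∀ z : Esp d, ‖lam • z‖ = lam * ‖z‖ := fun z => by
    rw [norm_smul, Real.norm_of_nonneg hlam.le]
  have hb : ∀ z : Esp d, blowUp u φ x₀ R (lam • z, lam * y)
      = lam * blowUp u φ x₀ (lam * R) (z, y) := fun z => by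
    simp only [blowUp, smul_smul, map_smul, smul_eq_mul, mul_comm R lam, mul_left_comm R lam]
    field_simp
  have h1 := h (lam • x) (lam • x') (lam * y) (by rw [hn]; nlinarith) (by rw [hn]; nlinarith)
    (by positivity) (by nlinarith)
  rw [hb, hb, ← smul_sub, hn] at h1
  nlinarith

theorem lipX_blowUp {K : ℝ} (hφ : C11Bound d P φ) (hx₀ : ‖x₀‖ < 1) (hR : 0 < R)
    (h : ∀ x x' : Esp d, ∀ y : ℝ, ‖x - x₀‖ < R → ‖x' - x₀‖ < R → 0 ≤ y → y < R →
      u (x, y) - u (x', y) ≤ K * ‖x - x'‖) :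
    LipX (K + P) (blowUp u φ x₀ R) 1 := by
  intro x x' y hx hx' hy hy1
  have hdist : ∀ x : Esp d, ‖x‖ < 1 → ‖x₀ + R • x - x₀‖ < R := fun x hx => by
    rw [add_sub_cancel_left, norm_smul, Real.norm_of_nonneg hR.le]; nlinarith
  have h1 := h (x₀ + R • x) (x₀ + R • x') (R * y) (hdist x hx) (hdist x' hx') (by positivity)
    (by nlinarith)
  rw [add_sub_add_left_eq_sub, ← smul_sub, norm_smul, Real.norm_of_nonneg hR.le] at h1
  have h2 : |fderiv ℝ φ x₀ (x' - x)| ≤ P * ‖x' - x‖ :=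
    ((fderiv ℝ φ x₀).le_opNorm _).trans (by gcongr; exact (hφ.1 x₀ hx₀).2.2)
  have h3 := (abs_le.1 h2).2
  rw [norm_sub_rev] at h3
  have h4 : blowUp u φ x₀ R (x, y) - blowUp u φ x₀ R (x', y)
      = R⁻¹ * (u (x₀ + R • x, R * y) - u (x₀ + R • x', R * y)) + fderiv ℝ φ x₀ (x' - x) := by
    simp only [blowUp, map_sub]
    ring
  have h5 : R⁻¹ * (u (x₀ + R • x, R * y) - u (x₀ + R • x', R * y)) ≤ K * ‖x - x'‖ := by
    rw [inv_mul_le_iff₀ hR]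
    linarith
  rw [h4]
  linarith

end blowUp

namespace FluxSol

variable {d : ℕ} {u : Esp d × ℝ → ℝ} {φ F : Esp d → ℝ} {Λ θ P : ℝ} {x₀ : Esp d}

theorem tangential_bound {ρ M : ℝ} (h : FluxSol u φ F Λ θ) (hφ : C11Bound d P φ) (hΛ : 0 < Λ)
    (hM : 0 < M) (hρ : 0 < ρ) (hΛρ : 8 * Λ * ρ ≤ 1) (hρ64 : ρ ≤ 1 / 64)
    (hsup : ∀ q : Esp d × ℝ, ‖q.1‖ ≤ 5 / 8 → 0 ≤ q.2 → q.2 ≤ 1 / 8 → |u q| ≤ M)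
    (hx₀ : ‖x₀‖ ≤ 17 / 32) {x x' : Esp d} {y : ℝ} (hx : ‖x - x₀‖ < ρ) (hx' : ‖x' - x₀‖ < ρ)
    (hy : 0 ≤ y) (hyρ : y < ρ) :
    u (x, y) - u (x', y) ≤ ((4 * d + 13) * M / ρ + 2 * P) * ‖x - x'‖ := by
  have hm : ‖(1 / 2 : ℝ) • (x + x') - x₀‖ ≤ ρ := by
    have : (1 / 2 : ℝ) • (x + x') - x₀ = (1 / 2 : ℝ) • ((x - x₀) + (x' - x₀)) := by module
    rw [this, norm_smul]
    have := norm_add_le (x - x₀) (x' - x₀)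
    norm_num
    linarith
  have hin : ∀ q, sqDist ((1 / 2 : ℝ) • (x + x')) y q ≤ ρ ^ 2 → ‖q.1‖ ≤ 5 / 8 ∧ q.2 ≤ 1 / 8 := by
    intro q hq
    obtain ⟨h1, h2⟩ := sqDist_le_imp hρ.le hq
    have h3 := norm_sub_le_norm_sub_add_norm_sub q.1 ((1 / 2 : ℝ) • (x + x')) x₀
    have h4 := norm_le_norm_add_norm_sub' q.1 x₀
    exact ⟨by linarith, by linarith [(abs_le.1 h2).2]⟩
  have hreg : ∀ q, sqDist ((1 / 2 : ℝ) • (x + x')) y q ≤ ρ ^ 2 → 0 ≤ q.2 →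
      ‖q.1‖ ^ 2 + q.2 ^ 2 < 1 := fun q hq h0 => by
    obtain ⟨h1, h2⟩ := hin q hq
    nlinarith [norm_nonneg q.1]
  refine tangential_lipschitz (F := F) rfl hy hρ hΛ hΛρ hM hφ.nonneg
    (h.cont.mono fun q hq => ⟨hreg q hq.1 hq.2, hq.2⟩)
    (fun q hq h0 => hsup q (hin q hq).1 h0 (hin q hq).2)
    (fun q hq h0 => h.lap q (hreg q hq.le h0.le) h0)
    (fun z hz => h.flux z ((hin _ hz.le).1.trans_lt (by norm_num))) ?_ ?_
  · intro z z' hz hz' hlt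
    have hz1 : ‖z‖ < 1 := (hin _ hz.le).1.trans_lt (by norm_num)
    have hz1' : ‖z'‖ < 1 := (hin _ hz'.le).1.trans_lt (by norm_num)
    have h1 := abs_le.1 (hφ.lipschitz hz1 hz1')
    have h2 := h.flux_mono z z' hz1 hz1' (by linarith)
    have h3 : Λ * ((u (z, 0) - φ z) - (u (z', 0) - φ z')) ≤ Λ * (2 * (u (z, 0) - u (z', 0))) :=
      mul_le_mul_of_nonneg_left (by linarith) hΛ.le
    linarith
  · have := norm_sub_le_norm_sub_add_norm_sub x x₀ x'
    rw [norm_sub_rev x₀ x'] at this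
    linarith

theorem one_sided_of_lipX {K₀ R₀ Kmax : ℝ} (h : FluxSol u φ F Λ θ) (hφ : C11Bound d P φ)
    (hθ : 0 < θ) (hΛ : 0 ≤ Λ) (hx₀ : ‖x₀‖ ≤ 17 / 32) (h₀ : u (x₀, 0) = φ x₀)
    (hK₀ : 96 * (d + 1) * K₀ = θ) (hR₀ : R₀ ≤ 1 / 4) (hPR : 16 * (P * R₀) ≤ K₀)
    (hΛK₀ : 8 * (Λ * R₀) * K₀ ≤ θ) (hΛK : 4 * (Λ * R₀) * Kmax < decayRate d * θ) (n : ℕ) :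
    ∀ R K : ℝ, 0 < R → R ≤ R₀ → K ≤ Kmax → K ≤ K₀ + n * (decayRate d * θ) →
      LipX K (blowUp u φ x₀ R) 1 →
      (∀ x, ‖x - x₀‖ ≤ (1 / (6144 * (d + 1))) ^ n * R / 4 → φ x ≤ u (x, 0)) ∨
      (∀ x, ‖x - x₀‖ ≤ (1 / (6144 * (d + 1))) ^ n * R / 4 → u (x, 0) ≤ φ x) := by
  have hP := hφ.nonneg
  have hd : (0 : ℝ) ≤ d := d.cast_nonneg
  have hK₀pos : 0 < K₀ := pos_of_mul_pos_right (hK₀ ▸ hθ) (by positivity)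
  have hκθ : 0 < decayRate d * θ := mul_pos (decayRate_pos d) hθ
  set lam : ℝ := 1 / (6144 * (d + 1)) with hlam
  have hlam0 : 0 < lam := by positivity
  have hlam1 : lam ≤ 1 := by rw [hlam, div_le_one (by positivity)]; nlinarith
  have hbase : ∀ n : ℕ, ∀ R K : ℝ, 0 < R → R ≤ R₀ → K ≤ K₀ → LipX K (blowUp u φ x₀ R) 1 →
      (∀ x, ‖x - x₀‖ ≤ lam ^ n * R / 4 → φ x ≤ u (x, 0)) ∨
      (∀ x, ‖x - x₀‖ ≤ lam ^ n * R / 4 → u (x, 0) ≤ φ x) := by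
    intro n R K hR hRR hK hL
    have hPR' : P * R ≤ P * R₀ := by gcongr
    have hΛR : Λ * R * K₀ ≤ Λ * R₀ * K₀ := by gcongr
    have hPRn : 0 ≤ P * R := by positivity
    have hscale : ∀ x : Esp d, ‖x - x₀‖ ≤ lam ^ n * R / 4 →
        ‖R⁻¹ • (x - x₀)‖ ≤ 1 / 4 ∧ x₀ + R • (R⁻¹ • (x - x₀)) = x := fun x hx => by
      have h1 : lam ^ n ≤ 1 := pow_le_one₀ hlam0.le hlam1
      refine ⟨?_, by rw [smul_inv_smul₀ hR.ne']; abel⟩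
      rw [norm_smul, Real.norm_of_nonneg (inv_nonneg.2 hR.le), inv_mul_le_iff₀ hR]
      nlinarith
    have hgap := fun x => blowUp_sub_obstBlowUp (u := u) (φ := φ) (x₀ := x₀) (R := R) x
    refine ((h.thinSol_blowUp hφ hR (hRR.trans hR₀) hx₀).one_sided hθ (by positivity) hK₀pos
      (by linarith) hK₀.le (by linarith) (hL.mono hK) (blowUp_zero h₀)
      obstBlowUp_zero).imp (fun hs x hx => ?_) (fun hs x hx => ?_)
    · obtain ⟨h1, h2⟩ := hscale x hx
      have h3 := sub_nonneg.2 (hs _ h1)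
      rw [hgap, h2] at h3
      exact sub_nonneg.1 (nonneg_of_mul_nonneg_right h3 (by positivity))
    · obtain ⟨h1, h2⟩ := hscale x hx
      have h3 := sub_nonpos.2 (hs _ h1)
      rw [hgap, h2] at h3
      exact sub_nonpos.1 (nonpos_of_mul_nonpos_right h3 (by positivity))
  induction n with
  | zero =>
    intro R K hR hRR _ hK hL
    exact hbase 0 R K hR hRR (by simpa using hK) hL
  | succ n ih =>
    intro R K hR hRR hKmax hK hL
    rcases le_or_gt K K₀ with hKK | hKK
    · exact hbase (n + 1) R K hR hRR hKK hL
    have hPR' : P * R ≤ P * R₀ := by gcongr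
    have hR₀0 : 0 < R₀ := by linarith
    have hK0 : 0 ≤ K := by linarith
    have hΛR : Λ * R * K ≤ Λ * R₀ * Kmax := by gcongr
    have hKθ : 96 * (d + 1) * K₀ ≤ 96 * (d + 1) * K := by gcongr
    have hL' := (h.thinSol_blowUp hφ hR (hRR.trans hR₀) hx₀).lipX_decay hθ (by positivity)
      (by linarith) (by positivity) (by linarith) (by linarith) hL (blowUp_zero h₀)
      obstBlowUp_zero
    have := ih (lam * R) _ (by positivity) (by nlinarith) (by linarith)
      (by push_cast at hK; linarith) (hL'.blowUp_mul hR hlam0)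
    rwa [← mul_assoc, ← pow_succ] at this

end FluxSol

theorem exists_phase_separation_radius (d : ℕ) (θ A L P : ℝ) (hθ : 0 < θ) (hP : 0 ≤ P) :
    ∃ r > 0, ∀ (f : ℝ → ℝ) (φ : Esp d → ℝ) (u : Esp d × ℝ → ℝ),
      GoodF θ L f → C11Bound d P φ → TwoPhaseSolH d θ f φ u →
      IntegrableOn (fun p => (u p)^2 + gradSqH d u p) (upBall d 1) volume →
      (∫ p in upBall d 1, (u p)^2) ≤ A^2 →
      ∀ x₀ : Esp d, ‖x₀‖ ≤ 17 / 32 → u (x₀, 0) = φ x₀ →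
        (∀ x, ‖x - x₀‖ ≤ r → φ x ≤ u (x, 0)) ∨ (∀ x, ‖x - x₀‖ ≤ r → u (x, 0) ≤ φ x) := by
  set Λ := |L| + 1 with hΛdef
  have hΛ : 0 < Λ := by positivity
  set M := 8 ^ (d + 1) * weightedBound d θ A with hMdef
  have hM : 0 < M := mul_pos (by positivity) (lt_max_of_lt_left (by linarith))
  set ρ := min (1 / (8 * Λ)) (1 / 64) with hρdef
  have hρ : 0 < ρ := by positivity
  have hΛρ : 8 * Λ * ρ ≤ 1 := by
    have : 8 * Λ * ρ ≤ 8 * Λ * (1 / (8 * Λ)) := by gcongr; exact min_le_left _ _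
    rwa [mul_one_div_cancel (by positivity)] at this
  have hρ64 : ρ ≤ 1 / 64 := min_le_right _ _
  set Kmax := (4 * d + 13) * M / ρ + 2 * P + P with hKdef
  have hKmax : 0 < Kmax := by positivity
  set K₀ := θ / (96 * (d + 1)) with hK₀def
  have hK₀ : 96 * (d + 1) * K₀ = θ := by rw [hK₀def]; field_simp
  have hK₀pos : 0 < K₀ := by positivity
  have hκθ : 0 < decayRate d * θ := mul_pos (decayRate_pos d) hθ
  obtain ⟨R₀, hR₀, hR₀ρ, hPR, hΛK₀, hΛK⟩ : ∃ R₀ : ℝ, 0 < R₀ ∧ R₀ ≤ ρ ∧ 16 * (P * R₀) ≤ K₀ ∧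
      8 * (Λ * R₀) * K₀ ≤ θ ∧ 4 * (Λ * R₀) * Kmax < decayRate d * θ := by
    have hlim : ∀ c : ℝ, Filter.Tendsto (fun R : ℝ => c * R) (𝓝[>] 0) (𝓝 0) := fun c =>
      ((continuous_const_mul c).tendsto' 0 0 (mul_zero c)).mono_left nhdsWithin_le_nhds
    have e1 := (hlim 1).eventually_lt_const hρ
    have e2 := (hlim (16 * P)).eventually_lt_const hK₀pos
    have e3 := (hlim (8 * Λ * K₀)).eventually_lt_const hθ
    have e4 := (hlim (4 * Λ * Kmax)).eventually_lt_const hκθ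
    obtain ⟨R, h1, h2, h3, h4, h5⟩ :=
      (e1.and (e2.and (e3.and (e4.and self_mem_nhdsWithin)))).exists
    exact ⟨R, h5, by linarith, by linarith, by linarith, by linarith⟩
  obtain ⟨n, hn⟩ := exists_nat_ge (Kmax / (decayRate d * θ))
  rw [div_le_iff₀ hκθ] at hn
  refine ⟨(1 / (6144 * (d + 1))) ^ n * R₀ / 4, by positivity, ?_⟩
  intro f φ u hf hφ hu hint hA x₀ hx₀ h₀
  obtain ⟨F, hF⟩ := hu.exists_fluxSol hf ((le_abs_self L).trans (by linarith)) hΛ.le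
  have hint' := integrableOn_sq_of_add (hu.1.mono subset_union_left) hint
  have hsup : ∀ q : Esp d × ℝ, ‖q.1‖ ≤ 5 / 8 → 0 ≤ q.2 → q.2 ≤ 1 / 8 → |u q| ≤ M :=
    fun q h1 h2 h3 => abs_le_of_integral_sq_le hθ hF.cont hF.lap
      (fun x hx => ⟨F x, hF.flux x hx, hF.flux_abs x hx⟩) hint' hA h1 h2 h3
  refine hF.one_sided_of_lipX hφ hθ hΛ.le hx₀ h₀ hK₀ (by linarith) hPR hΛK₀ hΛK n R₀ Kmax hR₀
    le_rfl le_rfl (by linarith) (lipX_blowUp hφ (by linarith) hR₀ ?_)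
  intro x x' y h1 h2 h3 h4
  exact hF.tangential_bound hφ hΛ hM hρ hΛρ hρ64 hsup hx₀ (h1.trans_le hR₀ρ) (h2.trans_le hR₀ρ)
    h3 (h4.trans_le hR₀ρ)

/-- Between a point above and a point below the obstacle there is a contact point. -/
theorem exists_contact {d : ℕ} {u : Esp d × ℝ → ℝ} {φ : Esp d → ℝ}
    (hu : ContinuousOn u (upBall d 1 ∪ flatBall d 1))
    (hφ : ∀ x : Esp d, ‖x‖ < 1 → DifferentiableAt ℝ φ x) {y z : Esp d} (hy : ‖y‖ < 1)
    (hz : ‖z‖ < 1) (hyu : u (y, 0) ≤ φ y) (hzu : φ z ≤ u (z, 0)) :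
    ∃ x₀ ∈ segment ℝ y z, u (x₀, 0) = φ x₀ := by
  have hseg : ∀ x ∈ segment ℝ y z, ‖x‖ < 1 := fun x hx => mem_ball_zero_iff.1 <|
    (convex_ball (0 : Esp d) 1).segment_subset (mem_ball_zero_iff.2 hy) (mem_ball_zero_iff.2 hz) hx
  have hc : ContinuousOn (fun x => u (x, 0)) (segment ℝ y z) :=
    hu.comp (by fun_prop) fun x hx => .inr ⟨by simpa using hseg x hx, rfl⟩
  exact (convex_segment y z).isPreconnected.intermediate_value₂ (left_mem_segment ℝ y z)
    (right_mem_segment ℝ y z) hc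
    (fun x hx => (hφ x (hseg x hx)).continuousAt.continuousWithinAt) hyu hzu

/-- **phase separation.** There is `r > 0`, depending only on `d`, `θ`,
`‖u‖_{L²(B₁⁺)}`, the Lipschitz constant of `f`, and `‖φ‖_{C^{1,1}}`, such that around every
point of `B'_{1/2}` the trace `u(·,0)` stays on one side of the obstacle `φ` at scale `r`.
In particular no point of `B'_{1/2}` lies in the closure of both phases. -/
theorem statement11
    (d : ℕ) (hd : 1 ≤ d) (θ A L P : ℝ) (hθ : 0 < θ) :
    ∃ r > 0, ∀ (f : ℝ → ℝ) (φ : Esp d → ℝ) (u : Esp d × ℝ → ℝ),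
      GoodF θ L f → C11Bound d P φ → TwoPhaseSolH d θ f φ u →
      IntegrableOn (fun p => (u p)^2 + gradSqH d u p) (upBall d 1) volume →
      (∫ p in upBall d 1, (u p)^2) ≤ A^2 →
      (∀ x : Esp d, ‖x‖ < 1/2 →
        ((∀ y : Esp d, ‖y - x‖ < r → ‖y‖ < 1 → φ y ≤ u (y, 0)) ∨
         (∀ y : Esp d, ‖y - x‖ < r → ‖y‖ < 1 → u (y, 0) ≤ φ y))) ∧
      (∀ x : Esp d, ‖x‖ < 1/2 →
        ¬(x ∈ closure {y : Esp d | ‖y‖ < 1 ∧ φ y < u (y, 0)} ∧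
          x ∈ closure {y : Esp d | ‖y‖ < 1 ∧ u (y, 0) < φ y})) := by
  rcases lt_or_ge P 0 with hP | hP
  · exact ⟨1, one_pos, fun f φ u _ hφ => absurd hφ.nonneg hP.not_ge⟩
  obtain ⟨r₁, hr₁, hsep⟩ := exists_phase_separation_radius d θ A L P hθ hP
  refine ⟨min (r₁ / 2) (1 / 32), by positivity, ?_⟩
  intro f φ u hf hφ hu hint hA
  set r := min (r₁ / 2) (1 / 32) with hr
  have hr0 : 0 < r := by positivity
  have hrr : r ≤ r₁ / 2 := min_le_left _ _
  have hr32 : r ≤ 1 / 32 := min_le_right _ _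
  have hnot : ∀ x y z : Esp d, ‖x‖ < 1 / 2 → ‖y - x‖ < r → ‖z - x‖ < r → ‖y‖ < 1 → ‖z‖ < 1 →
      u (y, 0) < φ y → φ z < u (z, 0) → False := by
    intro x y z hx hyx hzx hy hz hyu hzu
    obtain ⟨x₀, hx₀, h₀⟩ := exists_contact hu.1 (fun x hx => (hφ.1 x hx).1) hy hz hyu.le hzu.le
    have hx₀x : ‖x₀ - x‖ < r := mem_ball_iff_norm.1 <|
      (convex_ball x r).segment_subset (mem_ball_iff_norm.2 hyx) (mem_ball_iff_norm.2 hzx) hx₀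
    have hx₀n := norm_le_norm_add_norm_sub' x₀ x
    have hd : ∀ w : Esp d, ‖w - x‖ < r → ‖w - x₀‖ ≤ r₁ := fun w hw => by
      have := norm_sub_le_norm_sub_add_norm_sub w x x₀
      rw [norm_sub_rev x x₀] at this
      linarith
    rcases hsep f φ u hf hφ hu hint hA x₀ (by linarith) h₀ with h | h
    · exact (h y (hd y hyx)).not_gt hyu
    · exact (h z (hd z hzx)).not_gt hzu
  refine ⟨fun x hx => ?_, fun x hx ⟨h1, h2⟩ => ?_⟩
  · by_contra! hcon
    obtain ⟨⟨y, hyx, hy, hyu⟩, z, hzx, hz, hzu⟩ := hcon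
    exact hnot x y z hx hyx hzx hy hz hyu hzu
  · obtain ⟨z, ⟨hz, hzu⟩, hzx⟩ := Metric.mem_closure_iff.1 h1 r hr0
    obtain ⟨y, ⟨hy, hyu⟩, hyx⟩ := Metric.mem_closure_iff.1 h2 r hr0
    exact hnot x y z hx (by rwa [← dist_eq_norm, dist_comm]) (by rwa [← dist_eq_norm, dist_comm])
      hy hz hyu hzu
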